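/- Let B₁ and B₂ be bialgebras over a field k forming a matched pair: B₁ is a left B₂-module coalgebra via μ_l, B₂ is a right B₁-module coalgebra via μ_r, satisfying the matched pair identities (2.24) of Bespalov–Drabant with symmetric braiding, together with μ_r(η₂ ⊗ x) = ε₁(x)η₂, μ_l(y ⊗ η₁) = ε₂(y)η₁, and the compatibility τ ∘ (μ_l ⊗ μ_r) ∘ (id ⊗ τ ⊗ id) ∘ (Δ₂ ⊗ Δ₁) = (μ_r ⊗ μ_l) ∘ (id ⊗ τ ⊗ id) ∘ (Δ₂ ⊗ Δ₁) appropriately ordered. Then B₁ ⊗ B₂ with multiplication (m₁ ⊗ m₂) ∘ (id ⊗ (μ_l ⊗ μ_r) ∘ (id ⊗ τ ⊗ id) ∘ (Δ₂ ⊗ Δ₁) ⊗ id) and the tensor product comultiplication (id ⊗ τ ⊗ id) ∘ (Δ₁ ⊗ Δ₂) is a bialgebra (the double cross product B₁ ⋈ B₂). -/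

import Mathlib

open TensorProduct
open scoped TensorProduct

set_option maxHeartbeats 1000000
set_option linter.unusedVariables false

namespace CPB

section Combinators
variable {k : Type*} [CommRing k]
variable {A B C D R R' : Type*}
  [AddCommMonoid A] [Module k A] [AddCommMonoid B] [Module k B]
  [AddCommMonoid C] [Module k C] [AddCommMonoid D] [Module k D]
  [AddCommMonoid R] [Module k R] [AddCommMonoid R'] [Module k R']

/-- apply a map to the tail of a right-nested tensor product -/
noncomputable def skp (g : R →ₗ[k] R') : (A ⊗[k] R) →ₗ[k] (A ⊗[k] R') :=
  TensorProduct.map LinearMap.id g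

/-- apply a two-strand operation to the first two strands -/
noncomputable def pair2 (op : (A ⊗[k] B) →ₗ[k] (C ⊗[k] D)) :
    (A ⊗[k] (B ⊗[k] R)) →ₗ[k] (C ⊗[k] (D ⊗[k] R)) :=
  (TensorProduct.assoc k C D R).toLinearMap ∘ₗ
    TensorProduct.map op LinearMap.id ∘ₗ (TensorProduct.assoc k A B R).symm.toLinearMap

/-- multiply the first two strands together -/
noncomputable def merge2 (m : (A ⊗[k] B) →ₗ[k] C) :
    (A ⊗[k] (B ⊗[k] R)) →ₗ[k] (C ⊗[k] R) :=
  TensorProduct.map m LinearMap.id ∘ₗ (TensorProduct.assoc k A B R).symm.toLinearMap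

/-- split the first strand in two -/
noncomputable def split2 (d : A →ₗ[k] (C ⊗[k] D)) :
    (A ⊗[k] R) →ₗ[k] (C ⊗[k] (D ⊗[k] R)) :=
  (TensorProduct.assoc k C D R).toLinearMap ∘ₗ TensorProduct.map d LinearMap.id

/-- transpose the first two strands -/
noncomputable def swap2 : (A ⊗[k] (B ⊗[k] R)) →ₗ[k] (B ⊗[k] (A ⊗[k] R)) :=
  pair2 (TensorProduct.comm k A B).toLinearMap

/-- pair the two first strands off into a scalar -/
noncomputable def payL (p : (A ⊗[k] B) →ₗ[k] k) :
    (A ⊗[k] (B ⊗[k] R)) →ₗ[k] R :=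
  (TensorProduct.lid k R).toLinearMap ∘ₗ
    TensorProduct.map p LinearMap.id ∘ₗ (TensorProduct.assoc k A B R).symm.toLinearMap

end Combinators

section Apply4
variable {k : Type*} [CommRing k] {B1 B2 R : Type*}
  [AddCommMonoid B1] [Module k B1] [AddCommMonoid B2] [Module k B2]
  [AddCommMonoid R] [Module k R]

/-- apply an endomorphism of the four-fold tensor product to the first four strands -/
noncomputable def apply4
    (f : (B1 ⊗[k] (B2 ⊗[k] (B1 ⊗[k] B2))) →ₗ[k] (B1 ⊗[k] (B2 ⊗[k] (B1 ⊗[k] B2)))) :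
    (B1 ⊗[k] (B2 ⊗[k] (B1 ⊗[k] (B2 ⊗[k] R)))) →ₗ[k]
      (B1 ⊗[k] (B2 ⊗[k] (B1 ⊗[k] (B2 ⊗[k] R)))) :=
  letI E : ((B1 ⊗[k] (B2 ⊗[k] (B1 ⊗[k] B2))) ⊗[k] R) ≃ₗ[k]
      (B1 ⊗[k] (B2 ⊗[k] (B1 ⊗[k] (B2 ⊗[k] R)))) :=
    (TensorProduct.assoc k B1 (B2 ⊗[k] (B1 ⊗[k] B2)) R) ≪≫ₗ
      TensorProduct.congr (LinearEquiv.refl k B1)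
        ((TensorProduct.assoc k B2 (B1 ⊗[k] B2) R) ≪≫ₗ
          TensorProduct.congr (LinearEquiv.refl k B2) (TensorProduct.assoc k B1 B2 R))
  E.toLinearMap ∘ₗ TensorProduct.map f LinearMap.id ∘ₗ E.symm.toLinearMap

end Apply4

section Structures
variable (k : Type*) [CommRing k] (M : Type*) [AddCommMonoid M] [Module k M]

/-- `(M, mul, unit)` is an associative unital algebra (in terms of linear maps). -/
structure IsAlgMaps (mul : (M ⊗[k] M) →ₗ[k] M) (unit : k →ₗ[k] M) : Prop where
  mul_assoc :
    mul ∘ₗ TensorProduct.map mul LinearMap.id =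
      mul ∘ₗ TensorProduct.map LinearMap.id mul ∘ₗ (TensorProduct.assoc k M M M).toLinearMap
  one_mul :
    mul ∘ₗ TensorProduct.map unit LinearMap.id ∘ₗ (TensorProduct.lid k M).symm.toLinearMap =
      LinearMap.id
  mul_one :
    mul ∘ₗ TensorProduct.map LinearMap.id unit ∘ₗ (TensorProduct.rid k M).symm.toLinearMap =
      LinearMap.id

/-- `(M, comul, counit)` is a coassociative counital coalgebra (in terms of linear maps). -/
structure IsCoalgMaps (comul : M →ₗ[k] (M ⊗[k] M)) (counit : M →ₗ[k] k) : Prop where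
  coassoc :
    (TensorProduct.assoc k M M M).toLinearMap ∘ₗ TensorProduct.map comul LinearMap.id ∘ₗ comul =
      TensorProduct.map LinearMap.id comul ∘ₗ comul
  counit_left :
    (TensorProduct.lid k M).toLinearMap ∘ₗ TensorProduct.map counit LinearMap.id ∘ₗ comul =
      LinearMap.id
  counit_right :
    (TensorProduct.rid k M).toLinearMap ∘ₗ TensorProduct.map LinearMap.id counit ∘ₗ comul =
      LinearMap.id

/-- the given structure maps make `M` a bialgebra. -/
structure IsBialgebraMaps (mul : (M ⊗[k] M) →ₗ[k] M) (unit : k →ₗ[k] M)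
    (comul : M →ₗ[k] (M ⊗[k] M)) (counit : M →ₗ[k] k) : Prop where
  alg : IsAlgMaps k M mul unit
  coalg : IsCoalgMaps k M comul counit
  comul_mul :
    comul ∘ₗ mul =
      TensorProduct.map mul mul ∘ₗ (TensorProduct.tensorTensorTensorComm k M M M M).toLinearMap ∘ₗ
        TensorProduct.map comul comul
  counit_mul :
    counit ∘ₗ mul = LinearMap.mul' k k ∘ₗ TensorProduct.map counit counit
  comul_unit :
    comul ∘ₗ unit = TensorProduct.map unit unit ∘ₗ (TensorProduct.lid k k).symm.toLinearMap
  counit_unit : counit ∘ₗ unit = LinearMap.id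

/-- an object which is simultaneously an algebra and a coalgebra. -/
structure ACData where
  mul : (M ⊗[k] M) →ₗ[k] M
  unit : k →ₗ[k] M
  comul : M →ₗ[k] (M ⊗[k] M)
  counit : M →ₗ[k] k
  alg : IsAlgMaps k M mul unit
  coalg : IsCoalgMaps k M comul counit

end Structures

section Cross
variable {k : Type*} [CommRing k] {B1 B2 : Type*}
  [AddCommMonoid B1] [Module k B1] [AddCommMonoid B2] [Module k B2]

/-- the multiplication `(m₁ ⊗ m₂) ∘ (id ⊗ φ₂₁ ⊗ id)` of a would-be cross product bialgebra -/
noncomputable def crossMul (m1 : (B1 ⊗[k] B1) →ₗ[k] B1) (m2 : (B2 ⊗[k] B2) →ₗ[k] B2)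
    (phi21 : (B2 ⊗[k] B1) →ₗ[k] (B1 ⊗[k] B2)) :
    ((B1 ⊗[k] B2) ⊗[k] (B1 ⊗[k] B2)) →ₗ[k] (B1 ⊗[k] B2) :=
  ((skp m2) : (B1 ⊗[k] (B2 ⊗[k] B2)) →ₗ[k] (B1 ⊗[k] B2))
    ∘ₗ ((merge2 m1) : (B1 ⊗[k] (B1 ⊗[k] (B2 ⊗[k] B2))) →ₗ[k] (B1 ⊗[k] (B2 ⊗[k] B2)))
    ∘ₗ ((skp (pair2 phi21)) : (B1 ⊗[k] (B2 ⊗[k] (B1 ⊗[k] B2))) →ₗ[k]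
        (B1 ⊗[k] (B1 ⊗[k] (B2 ⊗[k] B2))))
    ∘ₗ (TensorProduct.assoc k B1 B2 (B1 ⊗[k] B2)).toLinearMap

/-- the unit `η₁ ⊗ η₂` of a would-be cross product bialgebra -/
noncomputable def crossUnit (eta1 : k →ₗ[k] B1) (eta2 : k →ₗ[k] B2) :
    k →ₗ[k] (B1 ⊗[k] B2) :=
  TensorProduct.map eta1 eta2 ∘ₗ (TensorProduct.lid k k).symm.toLinearMap

/-- the comultiplication `(id ⊗ φ₁₂ ⊗ id) ∘ (Δ₁ ⊗ Δ₂)` of a would-be cross product bialgebra -/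
noncomputable def crossComul (delta1 : B1 →ₗ[k] (B1 ⊗[k] B1)) (delta2 : B2 →ₗ[k] (B2 ⊗[k] B2))
    (phi12 : (B1 ⊗[k] B2) →ₗ[k] (B2 ⊗[k] B1)) :
    (B1 ⊗[k] B2) →ₗ[k] ((B1 ⊗[k] B2) ⊗[k] (B1 ⊗[k] B2)) :=
  (TensorProduct.assoc k B1 B2 (B1 ⊗[k] B2)).symm.toLinearMap
    ∘ₗ ((skp (pair2 phi12)) : (B1 ⊗[k] (B1 ⊗[k] (B2 ⊗[k] B2))) →ₗ[k]
        (B1 ⊗[k] (B2 ⊗[k] (B1 ⊗[k] B2))))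
    ∘ₗ ((skp (skp delta2)) : (B1 ⊗[k] (B1 ⊗[k] B2)) →ₗ[k] (B1 ⊗[k] (B1 ⊗[k] (B2 ⊗[k] B2))))
    ∘ₗ ((split2 delta1) : (B1 ⊗[k] B2) →ₗ[k] (B1 ⊗[k] (B1 ⊗[k] B2)))

/-- the counit `ε₁ ⊗ ε₂` of a would-be cross product bialgebra -/
noncomputable def crossCounit (eps1 : B1 →ₗ[k] k) (eps2 : B2 →ₗ[k] k) :
    (B1 ⊗[k] B2) →ₗ[k] k :=
  LinearMap.mul' k k ∘ₗ TensorProduct.map eps1 eps2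

end Cross


section HopfDatumSection
variable (k : Type*) [CommRing k] (B1 B2 : Type*)
  [AddCommMonoid B1] [Module k B1] [AddCommMonoid B2] [Module k B2]

noncomputable def ax_actL_act (m1 : (B1 ⊗[k] B1) →ₗ[k] B1) (eta1 : k →ₗ[k] B1)
    (delta1 : B1 →ₗ[k] (B1 ⊗[k] B1)) (eps1 : B1 →ₗ[k] k)
    (m2 : (B2 ⊗[k] B2) →ₗ[k] B2) (eta2 : k →ₗ[k] B2)
    (delta2 : B2 →ₗ[k] (B2 ⊗[k] B2)) (eps2 : B2 →ₗ[k] k)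
    (actL : (B2 ⊗[k] B1) →ₗ[k] B1) (coactL : B1 →ₗ[k] (B2 ⊗[k] B1))
    (actR : (B2 ⊗[k] B1) →ₗ[k] B2) (coactR : B2 →ₗ[k] (B2 ⊗[k] B1)) : Prop :=
    actL ∘ₗ ((merge2 m2) : (B2 ⊗[k] (B2 ⊗[k] B1)) →ₗ[k] (B2 ⊗[k] B1)) =
      actL ∘ₗ ((skp actL) : (B2 ⊗[k] (B2 ⊗[k] B1)) →ₗ[k] (B2 ⊗[k] B1))

noncomputable def ax_actL_unit (m1 : (B1 ⊗[k] B1) →ₗ[k] B1) (eta1 : k →ₗ[k] B1)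
    (delta1 : B1 →ₗ[k] (B1 ⊗[k] B1)) (eps1 : B1 →ₗ[k] k)
    (m2 : (B2 ⊗[k] B2) →ₗ[k] B2) (eta2 : k →ₗ[k] B2)
    (delta2 : B2 →ₗ[k] (B2 ⊗[k] B2)) (eps2 : B2 →ₗ[k] k)
    (actL : (B2 ⊗[k] B1) →ₗ[k] B1) (coactL : B1 →ₗ[k] (B2 ⊗[k] B1))
    (actR : (B2 ⊗[k] B1) →ₗ[k] B2) (coactR : B2 →ₗ[k] (B2 ⊗[k] B1)) : Prop :=
    actL ∘ₗ TensorProduct.map eta2 LinearMap.id ∘ₗ (TensorProduct.lid k B1).symm.toLinearMap =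
      LinearMap.id

noncomputable def ax_actR_act (m1 : (B1 ⊗[k] B1) →ₗ[k] B1) (eta1 : k →ₗ[k] B1)
    (delta1 : B1 →ₗ[k] (B1 ⊗[k] B1)) (eps1 : B1 →ₗ[k] k)
    (m2 : (B2 ⊗[k] B2) →ₗ[k] B2) (eta2 : k →ₗ[k] B2)
    (delta2 : B2 →ₗ[k] (B2 ⊗[k] B2)) (eps2 : B2 →ₗ[k] k)
    (actL : (B2 ⊗[k] B1) →ₗ[k] B1) (coactL : B1 →ₗ[k] (B2 ⊗[k] B1))
    (actR : (B2 ⊗[k] B1) →ₗ[k] B2) (coactR : B2 →ₗ[k] (B2 ⊗[k] B1)) : Prop :=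
    actR ∘ₗ ((skp m1) : (B2 ⊗[k] (B1 ⊗[k] B1)) →ₗ[k] (B2 ⊗[k] B1)) =
      actR ∘ₗ ((merge2 actR) : (B2 ⊗[k] (B1 ⊗[k] B1)) →ₗ[k] (B2 ⊗[k] B1))

noncomputable def ax_actR_unit (m1 : (B1 ⊗[k] B1) →ₗ[k] B1) (eta1 : k →ₗ[k] B1)
    (delta1 : B1 →ₗ[k] (B1 ⊗[k] B1)) (eps1 : B1 →ₗ[k] k)
    (m2 : (B2 ⊗[k] B2) →ₗ[k] B2) (eta2 : k →ₗ[k] B2)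
    (delta2 : B2 →ₗ[k] (B2 ⊗[k] B2)) (eps2 : B2 →ₗ[k] k)
    (actL : (B2 ⊗[k] B1) →ₗ[k] B1) (coactL : B1 →ₗ[k] (B2 ⊗[k] B1))
    (actR : (B2 ⊗[k] B1) →ₗ[k] B2) (coactR : B2 →ₗ[k] (B2 ⊗[k] B1)) : Prop :=
    actR ∘ₗ TensorProduct.map LinearMap.id eta1 ∘ₗ (TensorProduct.rid k B2).symm.toLinearMap =
      LinearMap.id

noncomputable def ax_coactL_coact (m1 : (B1 ⊗[k] B1) →ₗ[k] B1) (eta1 : k →ₗ[k] B1)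
    (delta1 : B1 →ₗ[k] (B1 ⊗[k] B1)) (eps1 : B1 →ₗ[k] k)
    (m2 : (B2 ⊗[k] B2) →ₗ[k] B2) (eta2 : k →ₗ[k] B2)
    (delta2 : B2 →ₗ[k] (B2 ⊗[k] B2)) (eps2 : B2 →ₗ[k] k)
    (actL : (B2 ⊗[k] B1) →ₗ[k] B1) (coactL : B1 →ₗ[k] (B2 ⊗[k] B1))
    (actR : (B2 ⊗[k] B1) →ₗ[k] B2) (coactR : B2 →ₗ[k] (B2 ⊗[k] B1)) : Prop :=
    ((split2 delta2) : (B2 ⊗[k] B1) →ₗ[k] (B2 ⊗[k] (B2 ⊗[k] B1))) ∘ₗ coactL =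
      ((skp coactL) : (B2 ⊗[k] B1) →ₗ[k] (B2 ⊗[k] (B2 ⊗[k] B1))) ∘ₗ coactL

noncomputable def ax_coactL_counit (m1 : (B1 ⊗[k] B1) →ₗ[k] B1) (eta1 : k →ₗ[k] B1)
    (delta1 : B1 →ₗ[k] (B1 ⊗[k] B1)) (eps1 : B1 →ₗ[k] k)
    (m2 : (B2 ⊗[k] B2) →ₗ[k] B2) (eta2 : k →ₗ[k] B2)
    (delta2 : B2 →ₗ[k] (B2 ⊗[k] B2)) (eps2 : B2 →ₗ[k] k)
    (actL : (B2 ⊗[k] B1) →ₗ[k] B1) (coactL : B1 →ₗ[k] (B2 ⊗[k] B1))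
    (actR : (B2 ⊗[k] B1) →ₗ[k] B2) (coactR : B2 →ₗ[k] (B2 ⊗[k] B1)) : Prop :=
    (TensorProduct.lid k B1).toLinearMap ∘ₗ TensorProduct.map eps2 LinearMap.id ∘ₗ coactL =
      LinearMap.id

noncomputable def ax_coactR_coact (m1 : (B1 ⊗[k] B1) →ₗ[k] B1) (eta1 : k →ₗ[k] B1)
    (delta1 : B1 →ₗ[k] (B1 ⊗[k] B1)) (eps1 : B1 →ₗ[k] k)
    (m2 : (B2 ⊗[k] B2) →ₗ[k] B2) (eta2 : k →ₗ[k] B2)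
    (delta2 : B2 →ₗ[k] (B2 ⊗[k] B2)) (eps2 : B2 →ₗ[k] k)
    (actL : (B2 ⊗[k] B1) →ₗ[k] B1) (coactL : B1 →ₗ[k] (B2 ⊗[k] B1))
    (actR : (B2 ⊗[k] B1) →ₗ[k] B2) (coactR : B2 →ₗ[k] (B2 ⊗[k] B1)) : Prop :=
    ((split2 coactR) : (B2 ⊗[k] B1) →ₗ[k] (B2 ⊗[k] (B1 ⊗[k] B1))) ∘ₗ coactR =
      ((skp delta1) : (B2 ⊗[k] B1) →ₗ[k] (B2 ⊗[k] (B1 ⊗[k] B1))) ∘ₗ coactR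

noncomputable def ax_coactR_counit (m1 : (B1 ⊗[k] B1) →ₗ[k] B1) (eta1 : k →ₗ[k] B1)
    (delta1 : B1 →ₗ[k] (B1 ⊗[k] B1)) (eps1 : B1 →ₗ[k] k)
    (m2 : (B2 ⊗[k] B2) →ₗ[k] B2) (eta2 : k →ₗ[k] B2)
    (delta2 : B2 →ₗ[k] (B2 ⊗[k] B2)) (eps2 : B2 →ₗ[k] k)
    (actL : (B2 ⊗[k] B1) →ₗ[k] B1) (coactL : B1 →ₗ[k] (B2 ⊗[k] B1))
    (actR : (B2 ⊗[k] B1) →ₗ[k] B2) (coactR : B2 →ₗ[k] (B2 ⊗[k] B1)) : Prop :=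
    (TensorProduct.rid k B2).toLinearMap ∘ₗ TensorProduct.map LinearMap.id eps1 ∘ₗ coactR =
      LinearMap.id

noncomputable def ax_actR_eta2 (m1 : (B1 ⊗[k] B1) →ₗ[k] B1) (eta1 : k →ₗ[k] B1)
    (delta1 : B1 →ₗ[k] (B1 ⊗[k] B1)) (eps1 : B1 →ₗ[k] k)
    (m2 : (B2 ⊗[k] B2) →ₗ[k] B2) (eta2 : k →ₗ[k] B2)
    (delta2 : B2 →ₗ[k] (B2 ⊗[k] B2)) (eps2 : B2 →ₗ[k] k)
    (actL : (B2 ⊗[k] B1) →ₗ[k] B1) (coactL : B1 →ₗ[k] (B2 ⊗[k] B1))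
    (actR : (B2 ⊗[k] B1) →ₗ[k] B2) (coactR : B2 →ₗ[k] (B2 ⊗[k] B1)) : Prop :=
    actR ∘ₗ TensorProduct.map eta2 LinearMap.id ∘ₗ (TensorProduct.lid k B1).symm.toLinearMap =
      eta2 ∘ₗ eps1

noncomputable def ax_coactL_eps1 (m1 : (B1 ⊗[k] B1) →ₗ[k] B1) (eta1 : k →ₗ[k] B1)
    (delta1 : B1 →ₗ[k] (B1 ⊗[k] B1)) (eps1 : B1 →ₗ[k] k)
    (m2 : (B2 ⊗[k] B2) →ₗ[k] B2) (eta2 : k →ₗ[k] B2)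
    (delta2 : B2 →ₗ[k] (B2 ⊗[k] B2)) (eps2 : B2 →ₗ[k] k)
    (actL : (B2 ⊗[k] B1) →ₗ[k] B1) (coactL : B1 →ₗ[k] (B2 ⊗[k] B1))
    (actR : (B2 ⊗[k] B1) →ₗ[k] B2) (coactR : B2 →ₗ[k] (B2 ⊗[k] B1)) : Prop :=
    (TensorProduct.rid k B2).toLinearMap ∘ₗ TensorProduct.map LinearMap.id eps1 ∘ₗ coactL =
      eta2 ∘ₗ eps1

noncomputable def ax_eps2_actR (m1 : (B1 ⊗[k] B1) →ₗ[k] B1) (eta1 : k →ₗ[k] B1)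
    (delta1 : B1 →ₗ[k] (B1 ⊗[k] B1)) (eps1 : B1 →ₗ[k] k)
    (m2 : (B2 ⊗[k] B2) →ₗ[k] B2) (eta2 : k →ₗ[k] B2)
    (delta2 : B2 →ₗ[k] (B2 ⊗[k] B2)) (eps2 : B2 →ₗ[k] k)
    (actL : (B2 ⊗[k] B1) →ₗ[k] B1) (coactL : B1 →ₗ[k] (B2 ⊗[k] B1))
    (actR : (B2 ⊗[k] B1) →ₗ[k] B2) (coactR : B2 →ₗ[k] (B2 ⊗[k] B1)) : Prop :=
    eps2 ∘ₗ actR = LinearMap.mul' k k ∘ₗ TensorProduct.map eps2 eps1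

noncomputable def ax_eps1_actL (m1 : (B1 ⊗[k] B1) →ₗ[k] B1) (eta1 : k →ₗ[k] B1)
    (delta1 : B1 →ₗ[k] (B1 ⊗[k] B1)) (eps1 : B1 →ₗ[k] k)
    (m2 : (B2 ⊗[k] B2) →ₗ[k] B2) (eta2 : k →ₗ[k] B2)
    (delta2 : B2 →ₗ[k] (B2 ⊗[k] B2)) (eps2 : B2 →ₗ[k] k)
    (actL : (B2 ⊗[k] B1) →ₗ[k] B1) (coactL : B1 →ₗ[k] (B2 ⊗[k] B1))
    (actR : (B2 ⊗[k] B1) →ₗ[k] B2) (coactR : B2 →ₗ[k] (B2 ⊗[k] B1)) : Prop :=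
    eps1 ∘ₗ actL = LinearMap.mul' k k ∘ₗ TensorProduct.map eps2 eps1

noncomputable def ax_actL_eta1 (m1 : (B1 ⊗[k] B1) →ₗ[k] B1) (eta1 : k →ₗ[k] B1)
    (delta1 : B1 →ₗ[k] (B1 ⊗[k] B1)) (eps1 : B1 →ₗ[k] k)
    (m2 : (B2 ⊗[k] B2) →ₗ[k] B2) (eta2 : k →ₗ[k] B2)
    (delta2 : B2 →ₗ[k] (B2 ⊗[k] B2)) (eps2 : B2 →ₗ[k] k)
    (actL : (B2 ⊗[k] B1) →ₗ[k] B1) (coactL : B1 →ₗ[k] (B2 ⊗[k] B1))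
    (actR : (B2 ⊗[k] B1) →ₗ[k] B2) (coactR : B2 →ₗ[k] (B2 ⊗[k] B1)) : Prop :=
    actL ∘ₗ TensorProduct.map LinearMap.id eta1 ∘ₗ (TensorProduct.rid k B2).symm.toLinearMap =
      eta1 ∘ₗ eps2

noncomputable def ax_coactR_eps2 (m1 : (B1 ⊗[k] B1) →ₗ[k] B1) (eta1 : k →ₗ[k] B1)
    (delta1 : B1 →ₗ[k] (B1 ⊗[k] B1)) (eps1 : B1 →ₗ[k] k)
    (m2 : (B2 ⊗[k] B2) →ₗ[k] B2) (eta2 : k →ₗ[k] B2)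
    (delta2 : B2 →ₗ[k] (B2 ⊗[k] B2)) (eps2 : B2 →ₗ[k] k)
    (actL : (B2 ⊗[k] B1) →ₗ[k] B1) (coactL : B1 →ₗ[k] (B2 ⊗[k] B1))
    (actR : (B2 ⊗[k] B1) →ₗ[k] B2) (coactR : B2 →ₗ[k] (B2 ⊗[k] B1)) : Prop :=
    (TensorProduct.lid k B1).toLinearMap ∘ₗ TensorProduct.map eps2 LinearMap.id ∘ₗ coactR =
      eta1 ∘ₗ eps2

noncomputable def ax_coactR_eta2 (m1 : (B1 ⊗[k] B1) →ₗ[k] B1) (eta1 : k →ₗ[k] B1)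
    (delta1 : B1 →ₗ[k] (B1 ⊗[k] B1)) (eps1 : B1 →ₗ[k] k)
    (m2 : (B2 ⊗[k] B2) →ₗ[k] B2) (eta2 : k →ₗ[k] B2)
    (delta2 : B2 →ₗ[k] (B2 ⊗[k] B2)) (eps2 : B2 →ₗ[k] k)
    (actL : (B2 ⊗[k] B1) →ₗ[k] B1) (coactL : B1 →ₗ[k] (B2 ⊗[k] B1))
    (actR : (B2 ⊗[k] B1) →ₗ[k] B2) (coactR : B2 →ₗ[k] (B2 ⊗[k] B1)) : Prop :=
    coactR ∘ₗ eta2 = TensorProduct.map eta2 eta1 ∘ₗ (TensorProduct.lid k k).symm.toLinearMap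

noncomputable def ax_coactL_eta1 (m1 : (B1 ⊗[k] B1) →ₗ[k] B1) (eta1 : k →ₗ[k] B1)
    (delta1 : B1 →ₗ[k] (B1 ⊗[k] B1)) (eps1 : B1 →ₗ[k] k)
    (m2 : (B2 ⊗[k] B2) →ₗ[k] B2) (eta2 : k →ₗ[k] B2)
    (delta2 : B2 →ₗ[k] (B2 ⊗[k] B2)) (eps2 : B2 →ₗ[k] k)
    (actL : (B2 ⊗[k] B1) →ₗ[k] B1) (coactL : B1 →ₗ[k] (B2 ⊗[k] B1))
    (actR : (B2 ⊗[k] B1) →ₗ[k] B2) (coactR : B2 →ₗ[k] (B2 ⊗[k] B1)) : Prop :=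
    coactL ∘ₗ eta1 = TensorProduct.map eta2 eta1 ∘ₗ (TensorProduct.lid k k).symm.toLinearMap

noncomputable def ax_algCoalg1 (m1 : (B1 ⊗[k] B1) →ₗ[k] B1) (eta1 : k →ₗ[k] B1)
    (delta1 : B1 →ₗ[k] (B1 ⊗[k] B1)) (eps1 : B1 →ₗ[k] k)
    (m2 : (B2 ⊗[k] B2) →ₗ[k] B2) (eta2 : k →ₗ[k] B2)
    (delta2 : B2 →ₗ[k] (B2 ⊗[k] B2)) (eps2 : B2 →ₗ[k] k)
    (actL : (B2 ⊗[k] B1) →ₗ[k] B1) (coactL : B1 →ₗ[k] (B2 ⊗[k] B1))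
    (actR : (B2 ⊗[k] B1) →ₗ[k] B2) (coactR : B2 →ₗ[k] (B2 ⊗[k] B1)) : Prop :=
    (delta1 : B1 →ₗ[k] (B1 ⊗[k] B1))
      ∘ₗ (m1 : (B1 ⊗[k] B1) →ₗ[k] B1)
    =
    ((skp m1) : (B1 ⊗[k] (B1 ⊗[k] B1)) →ₗ[k] (B1 ⊗[k] B1))
      ∘ₗ ((merge2 m1) : (B1 ⊗[k] (B1 ⊗[k] (B1 ⊗[k] B1))) →ₗ[k] (B1 ⊗[k] (B1 ⊗[k] B1)))
      ∘ₗ ((skp (merge2 actL)) : (B1 ⊗[k] (B2 ⊗[k] (B1 ⊗[k] (B1 ⊗[k] B1)))) →ₗ[k] (B1 ⊗[k] (B1 ⊗[k] (B1 ⊗[k] B1))))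
      ∘ₗ ((skp (skp swap2)) : (B1 ⊗[k] (B2 ⊗[k] (B1 ⊗[k] (B1 ⊗[k] B1)))) →ₗ[k] (B1 ⊗[k] (B2 ⊗[k] (B1 ⊗[k] (B1 ⊗[k] B1)))))
      ∘ₗ ((skp (split2 coactL)) : (B1 ⊗[k] (B1 ⊗[k] (B1 ⊗[k] B1))) →ₗ[k] (B1 ⊗[k] (B2 ⊗[k] (B1 ⊗[k] (B1 ⊗[k] B1)))))
      ∘ₗ ((skp (skp delta1)) : (B1 ⊗[k] (B1 ⊗[k] B1)) →ₗ[k] (B1 ⊗[k] (B1 ⊗[k] (B1 ⊗[k] B1))))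
      ∘ₗ ((split2 delta1) : (B1 ⊗[k] B1) →ₗ[k] (B1 ⊗[k] (B1 ⊗[k] B1)))

noncomputable def ax_algCoalg2 (m1 : (B1 ⊗[k] B1) →ₗ[k] B1) (eta1 : k →ₗ[k] B1)
    (delta1 : B1 →ₗ[k] (B1 ⊗[k] B1)) (eps1 : B1 →ₗ[k] k)
    (m2 : (B2 ⊗[k] B2) →ₗ[k] B2) (eta2 : k →ₗ[k] B2)
    (delta2 : B2 →ₗ[k] (B2 ⊗[k] B2)) (eps2 : B2 →ₗ[k] k)
    (actL : (B2 ⊗[k] B1) →ₗ[k] B1) (coactL : B1 →ₗ[k] (B2 ⊗[k] B1))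
    (actR : (B2 ⊗[k] B1) →ₗ[k] B2) (coactR : B2 →ₗ[k] (B2 ⊗[k] B1)) : Prop :=
    (delta2 : B2 →ₗ[k] (B2 ⊗[k] B2))
      ∘ₗ (m2 : (B2 ⊗[k] B2) →ₗ[k] B2)
    =
    ((skp m2) : (B2 ⊗[k] (B2 ⊗[k] B2)) →ₗ[k] (B2 ⊗[k] B2))
      ∘ₗ ((merge2 m2) : (B2 ⊗[k] (B2 ⊗[k] (B2 ⊗[k] B2))) →ₗ[k] (B2 ⊗[k] (B2 ⊗[k] B2)))
      ∘ₗ ((skp (skp (merge2 actR))) : (B2 ⊗[k] (B2 ⊗[k] (B2 ⊗[k] (B1 ⊗[k] B2)))) →ₗ[k] (B2 ⊗[k] (B2 ⊗[k] (B2 ⊗[k] B2))))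
      ∘ₗ ((skp swap2) : (B2 ⊗[k] (B2 ⊗[k] (B2 ⊗[k] (B1 ⊗[k] B2)))) →ₗ[k] (B2 ⊗[k] (B2 ⊗[k] (B2 ⊗[k] (B1 ⊗[k] B2)))))
      ∘ₗ ((skp (skp (split2 coactR))) : (B2 ⊗[k] (B2 ⊗[k] (B2 ⊗[k] B2))) →ₗ[k] (B2 ⊗[k] (B2 ⊗[k] (B2 ⊗[k] (B1 ⊗[k] B2)))))
      ∘ₗ ((skp (skp delta2)) : (B2 ⊗[k] (B2 ⊗[k] B2)) →ₗ[k] (B2 ⊗[k] (B2 ⊗[k] (B2 ⊗[k] B2))))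
      ∘ₗ ((split2 delta2) : (B2 ⊗[k] B2) →ₗ[k] (B2 ⊗[k] (B2 ⊗[k] B2)))

noncomputable def ax_modComod (m1 : (B1 ⊗[k] B1) →ₗ[k] B1) (eta1 : k →ₗ[k] B1)
    (delta1 : B1 →ₗ[k] (B1 ⊗[k] B1)) (eps1 : B1 →ₗ[k] k)
    (m2 : (B2 ⊗[k] B2) →ₗ[k] B2) (eta2 : k →ₗ[k] B2)
    (delta2 : B2 →ₗ[k] (B2 ⊗[k] B2)) (eps2 : B2 →ₗ[k] k)
    (actL : (B2 ⊗[k] B1) →ₗ[k] B1) (coactL : B1 →ₗ[k] (B2 ⊗[k] B1))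
    (actR : (B2 ⊗[k] B1) →ₗ[k] B2) (coactR : B2 →ₗ[k] (B2 ⊗[k] B1)) : Prop :=
    ((skp m1) : (B2 ⊗[k] (B1 ⊗[k] B1)) →ₗ[k] (B2 ⊗[k] B1))
      ∘ₗ ((merge2 m2) : (B2 ⊗[k] (B2 ⊗[k] (B1 ⊗[k] B1))) →ₗ[k] (B2 ⊗[k] (B1 ⊗[k] B1)))
      ∘ₗ ((skp swap2) : (B2 ⊗[k] (B1 ⊗[k] (B2 ⊗[k] B1))) →ₗ[k] (B2 ⊗[k] (B2 ⊗[k] (B1 ⊗[k] B1))))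
      ∘ₗ ((skp (skp coactR)) : (B2 ⊗[k] (B1 ⊗[k] B2)) →ₗ[k] (B2 ⊗[k] (B1 ⊗[k] (B2 ⊗[k] B1))))
      ∘ₗ ((split2 coactL) : (B1 ⊗[k] B2) →ₗ[k] (B2 ⊗[k] (B1 ⊗[k] B2)))
      ∘ₗ ((skp actR) : (B1 ⊗[k] (B2 ⊗[k] B1)) →ₗ[k] (B1 ⊗[k] B2))
      ∘ₗ ((merge2 actL) : (B2 ⊗[k] (B1 ⊗[k] (B2 ⊗[k] B1))) →ₗ[k] (B1 ⊗[k] (B2 ⊗[k] B1)))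
      ∘ₗ ((skp swap2) : (B2 ⊗[k] (B2 ⊗[k] (B1 ⊗[k] B1))) →ₗ[k] (B2 ⊗[k] (B1 ⊗[k] (B2 ⊗[k] B1))))
      ∘ₗ ((skp (skp delta1)) : (B2 ⊗[k] (B2 ⊗[k] B1)) →ₗ[k] (B2 ⊗[k] (B2 ⊗[k] (B1 ⊗[k] B1))))
      ∘ₗ ((split2 delta2) : (B2 ⊗[k] B1) →ₗ[k] (B2 ⊗[k] (B2 ⊗[k] B1)))
    =
    ((skp m1) : (B2 ⊗[k] (B1 ⊗[k] B1)) →ₗ[k] (B2 ⊗[k] B1))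
      ∘ₗ ((merge2 m2) : (B2 ⊗[k] (B2 ⊗[k] (B1 ⊗[k] B1))) →ₗ[k] (B2 ⊗[k] (B1 ⊗[k] B1)))
      ∘ₗ ((skp (skp (skp actL))) : (B2 ⊗[k] (B2 ⊗[k] (B1 ⊗[k] (B2 ⊗[k] B1)))) →ₗ[k] (B2 ⊗[k] (B2 ⊗[k] (B1 ⊗[k] B1))))
      ∘ₗ ((skp swap2) : (B2 ⊗[k] (B1 ⊗[k] (B2 ⊗[k] (B2 ⊗[k] B1)))) →ₗ[k] (B2 ⊗[k] (B2 ⊗[k] (B1 ⊗[k] (B2 ⊗[k] B1)))))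
      ∘ₗ ((merge2 actR) : (B2 ⊗[k] (B1 ⊗[k] (B1 ⊗[k] (B2 ⊗[k] (B2 ⊗[k] B1))))) →ₗ[k] (B2 ⊗[k] (B1 ⊗[k] (B2 ⊗[k] (B2 ⊗[k] B1)))))
      ∘ₗ ((skp (skp (skp swap2))) : (B2 ⊗[k] (B1 ⊗[k] (B1 ⊗[k] (B2 ⊗[k] (B2 ⊗[k] B1))))) →ₗ[k] (B2 ⊗[k] (B1 ⊗[k] (B1 ⊗[k] (B2 ⊗[k] (B2 ⊗[k] B1))))))
      ∘ₗ ((skp swap2) : (B2 ⊗[k] (B1 ⊗[k] (B1 ⊗[k] (B2 ⊗[k] (B2 ⊗[k] B1))))) →ₗ[k] (B2 ⊗[k] (B1 ⊗[k] (B1 ⊗[k] (B2 ⊗[k] (B2 ⊗[k] B1))))))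
      ∘ₗ ((skp (skp (skp (skp coactL)))) : (B2 ⊗[k] (B1 ⊗[k] (B1 ⊗[k] (B2 ⊗[k] B1)))) →ₗ[k] (B2 ⊗[k] (B1 ⊗[k] (B1 ⊗[k] (B2 ⊗[k] (B2 ⊗[k] B1))))))
      ∘ₗ ((skp (skp swap2)) : (B2 ⊗[k] (B1 ⊗[k] (B2 ⊗[k] (B1 ⊗[k] B1)))) →ₗ[k] (B2 ⊗[k] (B1 ⊗[k] (B1 ⊗[k] (B2 ⊗[k] B1)))))
      ∘ₗ ((split2 coactR) : (B2 ⊗[k] (B2 ⊗[k] (B1 ⊗[k] B1))) →ₗ[k] (B2 ⊗[k] (B1 ⊗[k] (B2 ⊗[k] (B1 ⊗[k] B1)))))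
      ∘ₗ ((skp (skp delta1)) : (B2 ⊗[k] (B2 ⊗[k] B1)) →ₗ[k] (B2 ⊗[k] (B2 ⊗[k] (B1 ⊗[k] B1))))
      ∘ₗ ((split2 delta2) : (B2 ⊗[k] B1) →ₗ[k] (B2 ⊗[k] (B2 ⊗[k] B1)))

noncomputable def ax_modAlg1 (m1 : (B1 ⊗[k] B1) →ₗ[k] B1) (eta1 : k →ₗ[k] B1)
    (delta1 : B1 →ₗ[k] (B1 ⊗[k] B1)) (eps1 : B1 →ₗ[k] k)
    (m2 : (B2 ⊗[k] B2) →ₗ[k] B2) (eta2 : k →ₗ[k] B2)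
    (delta2 : B2 →ₗ[k] (B2 ⊗[k] B2)) (eps2 : B2 →ₗ[k] k)
    (actL : (B2 ⊗[k] B1) →ₗ[k] B1) (coactL : B1 →ₗ[k] (B2 ⊗[k] B1))
    (actR : (B2 ⊗[k] B1) →ₗ[k] B2) (coactR : B2 →ₗ[k] (B2 ⊗[k] B1)) : Prop :=
    (actR : (B2 ⊗[k] B1) →ₗ[k] B2)
      ∘ₗ ((merge2 m2) : (B2 ⊗[k] (B2 ⊗[k] B1)) →ₗ[k] (B2 ⊗[k] B1))
    =
    (m2 : (B2 ⊗[k] B2) →ₗ[k] B2)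
      ∘ₗ ((merge2 actR) : (B2 ⊗[k] (B1 ⊗[k] B2)) →ₗ[k] (B2 ⊗[k] B2))
      ∘ₗ ((skp (skp actR)) : (B2 ⊗[k] (B1 ⊗[k] (B2 ⊗[k] B1))) →ₗ[k] (B2 ⊗[k] (B1 ⊗[k] B2)))
      ∘ₗ ((skp (merge2 actL)) : (B2 ⊗[k] (B2 ⊗[k] (B1 ⊗[k] (B2 ⊗[k] B1)))) →ₗ[k] (B2 ⊗[k] (B1 ⊗[k] (B2 ⊗[k] B1))))
      ∘ₗ ((skp (skp swap2)) : (B2 ⊗[k] (B2 ⊗[k] (B2 ⊗[k] (B1 ⊗[k] B1)))) →ₗ[k] (B2 ⊗[k] (B2 ⊗[k] (B1 ⊗[k] (B2 ⊗[k] B1)))))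
      ∘ₗ ((skp (skp (skp delta1))) : (B2 ⊗[k] (B2 ⊗[k] (B2 ⊗[k] B1))) →ₗ[k] (B2 ⊗[k] (B2 ⊗[k] (B2 ⊗[k] (B1 ⊗[k] B1)))))
      ∘ₗ ((skp (split2 delta2)) : (B2 ⊗[k] (B2 ⊗[k] B1)) →ₗ[k] (B2 ⊗[k] (B2 ⊗[k] (B2 ⊗[k] B1))))

noncomputable def ax_modAlg2 (m1 : (B1 ⊗[k] B1) →ₗ[k] B1) (eta1 : k →ₗ[k] B1)
    (delta1 : B1 →ₗ[k] (B1 ⊗[k] B1)) (eps1 : B1 →ₗ[k] k)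
    (m2 : (B2 ⊗[k] B2) →ₗ[k] B2) (eta2 : k →ₗ[k] B2)
    (delta2 : B2 →ₗ[k] (B2 ⊗[k] B2)) (eps2 : B2 →ₗ[k] k)
    (actL : (B2 ⊗[k] B1) →ₗ[k] B1) (coactL : B1 →ₗ[k] (B2 ⊗[k] B1))
    (actR : (B2 ⊗[k] B1) →ₗ[k] B2) (coactR : B2 →ₗ[k] (B2 ⊗[k] B1)) : Prop :=
    (actL : (B2 ⊗[k] B1) →ₗ[k] B1)
      ∘ₗ ((skp m1) : (B2 ⊗[k] (B1 ⊗[k] B1)) →ₗ[k] (B2 ⊗[k] B1))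
    =
    (m1 : (B1 ⊗[k] B1) →ₗ[k] B1)
      ∘ₗ ((skp actL) : (B1 ⊗[k] (B2 ⊗[k] B1)) →ₗ[k] (B1 ⊗[k] B1))
      ∘ₗ ((skp (merge2 actR)) : (B1 ⊗[k] (B2 ⊗[k] (B1 ⊗[k] B1))) →ₗ[k] (B1 ⊗[k] (B2 ⊗[k] B1)))
      ∘ₗ ((merge2 actL) : (B2 ⊗[k] (B1 ⊗[k] (B2 ⊗[k] (B1 ⊗[k] B1)))) →ₗ[k] (B1 ⊗[k] (B2 ⊗[k] (B1 ⊗[k] B1))))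
      ∘ₗ ((skp swap2) : (B2 ⊗[k] (B2 ⊗[k] (B1 ⊗[k] (B1 ⊗[k] B1)))) →ₗ[k] (B2 ⊗[k] (B1 ⊗[k] (B2 ⊗[k] (B1 ⊗[k] B1)))))
      ∘ₗ ((skp (skp (split2 delta1))) : (B2 ⊗[k] (B2 ⊗[k] (B1 ⊗[k] B1))) →ₗ[k] (B2 ⊗[k] (B2 ⊗[k] (B1 ⊗[k] (B1 ⊗[k] B1)))))
      ∘ₗ ((split2 delta2) : (B2 ⊗[k] (B1 ⊗[k] B1)) →ₗ[k] (B2 ⊗[k] (B2 ⊗[k] (B1 ⊗[k] B1))))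

noncomputable def ax_comodCoalg1 (m1 : (B1 ⊗[k] B1) →ₗ[k] B1) (eta1 : k →ₗ[k] B1)
    (delta1 : B1 →ₗ[k] (B1 ⊗[k] B1)) (eps1 : B1 →ₗ[k] k)
    (m2 : (B2 ⊗[k] B2) →ₗ[k] B2) (eta2 : k →ₗ[k] B2)
    (delta2 : B2 →ₗ[k] (B2 ⊗[k] B2)) (eps2 : B2 →ₗ[k] k)
    (actL : (B2 ⊗[k] B1) →ₗ[k] B1) (coactL : B1 →ₗ[k] (B2 ⊗[k] B1))
    (actR : (B2 ⊗[k] B1) →ₗ[k] B2) (coactR : B2 →ₗ[k] (B2 ⊗[k] B1)) : Prop :=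
    ((split2 delta2) : (B2 ⊗[k] B1) →ₗ[k] (B2 ⊗[k] (B2 ⊗[k] B1)))
      ∘ₗ (coactR : B2 →ₗ[k] (B2 ⊗[k] B1))
    =
    ((skp (skp m1)) : (B2 ⊗[k] (B2 ⊗[k] (B1 ⊗[k] B1))) →ₗ[k] (B2 ⊗[k] (B2 ⊗[k] B1)))
      ∘ₗ ((skp (merge2 m2)) : (B2 ⊗[k] (B2 ⊗[k] (B2 ⊗[k] (B1 ⊗[k] B1)))) →ₗ[k] (B2 ⊗[k] (B2 ⊗[k] (B1 ⊗[k] B1))))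
      ∘ₗ ((skp (skp swap2)) : (B2 ⊗[k] (B2 ⊗[k] (B1 ⊗[k] (B2 ⊗[k] B1)))) →ₗ[k] (B2 ⊗[k] (B2 ⊗[k] (B2 ⊗[k] (B1 ⊗[k] B1)))))
      ∘ₗ ((skp (skp (skp coactR))) : (B2 ⊗[k] (B2 ⊗[k] (B1 ⊗[k] B2))) →ₗ[k] (B2 ⊗[k] (B2 ⊗[k] (B1 ⊗[k] (B2 ⊗[k] B1)))))
      ∘ₗ ((skp (split2 coactL)) : (B2 ⊗[k] (B1 ⊗[k] B2)) →ₗ[k] (B2 ⊗[k] (B2 ⊗[k] (B1 ⊗[k] B2))))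
      ∘ₗ ((split2 coactR) : (B2 ⊗[k] B2) →ₗ[k] (B2 ⊗[k] (B1 ⊗[k] B2)))
      ∘ₗ (delta2 : B2 →ₗ[k] (B2 ⊗[k] B2))

noncomputable def ax_comodCoalg2 (m1 : (B1 ⊗[k] B1) →ₗ[k] B1) (eta1 : k →ₗ[k] B1)
    (delta1 : B1 →ₗ[k] (B1 ⊗[k] B1)) (eps1 : B1 →ₗ[k] k)
    (m2 : (B2 ⊗[k] B2) →ₗ[k] B2) (eta2 : k →ₗ[k] B2)
    (delta2 : B2 →ₗ[k] (B2 ⊗[k] B2)) (eps2 : B2 →ₗ[k] k)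
    (actL : (B2 ⊗[k] B1) →ₗ[k] B1) (coactL : B1 →ₗ[k] (B2 ⊗[k] B1))
    (actR : (B2 ⊗[k] B1) →ₗ[k] B2) (coactR : B2 →ₗ[k] (B2 ⊗[k] B1)) : Prop :=
    ((skp delta1) : (B2 ⊗[k] B1) →ₗ[k] (B2 ⊗[k] (B1 ⊗[k] B1)))
      ∘ₗ (coactL : B1 →ₗ[k] (B2 ⊗[k] B1))
    =
    ((skp (merge2 m1)) : (B2 ⊗[k] (B1 ⊗[k] (B1 ⊗[k] B1))) →ₗ[k] (B2 ⊗[k] (B1 ⊗[k] B1)))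
      ∘ₗ ((merge2 m2) : (B2 ⊗[k] (B2 ⊗[k] (B1 ⊗[k] (B1 ⊗[k] B1)))) →ₗ[k] (B2 ⊗[k] (B1 ⊗[k] (B1 ⊗[k] B1))))
      ∘ₗ ((skp swap2) : (B2 ⊗[k] (B1 ⊗[k] (B2 ⊗[k] (B1 ⊗[k] B1)))) →ₗ[k] (B2 ⊗[k] (B2 ⊗[k] (B1 ⊗[k] (B1 ⊗[k] B1)))))
      ∘ₗ ((skp (skp (split2 coactR))) : (B2 ⊗[k] (B1 ⊗[k] (B2 ⊗[k] B1))) →ₗ[k] (B2 ⊗[k] (B1 ⊗[k] (B2 ⊗[k] (B1 ⊗[k] B1)))))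
      ∘ₗ ((skp (skp coactL)) : (B2 ⊗[k] (B1 ⊗[k] B1)) →ₗ[k] (B2 ⊗[k] (B1 ⊗[k] (B2 ⊗[k] B1))))
      ∘ₗ ((split2 coactL) : (B1 ⊗[k] B1) →ₗ[k] (B2 ⊗[k] (B1 ⊗[k] B1)))
      ∘ₗ (delta1 : B1 →ₗ[k] (B1 ⊗[k] B1))

noncomputable def ax_modCoalg1 (m1 : (B1 ⊗[k] B1) →ₗ[k] B1) (eta1 : k →ₗ[k] B1)
    (delta1 : B1 →ₗ[k] (B1 ⊗[k] B1)) (eps1 : B1 →ₗ[k] k)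
    (m2 : (B2 ⊗[k] B2) →ₗ[k] B2) (eta2 : k →ₗ[k] B2)
    (delta2 : B2 →ₗ[k] (B2 ⊗[k] B2)) (eps2 : B2 →ₗ[k] k)
    (actL : (B2 ⊗[k] B1) →ₗ[k] B1) (coactL : B1 →ₗ[k] (B2 ⊗[k] B1))
    (actR : (B2 ⊗[k] B1) →ₗ[k] B2) (coactR : B2 →ₗ[k] (B2 ⊗[k] B1)) : Prop :=
    (delta2 : B2 →ₗ[k] (B2 ⊗[k] B2))
      ∘ₗ (actR : (B2 ⊗[k] B1) →ₗ[k] B2)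
    =
    ((merge2 m2) : (B2 ⊗[k] (B2 ⊗[k] B2)) →ₗ[k] (B2 ⊗[k] B2))
      ∘ₗ ((skp (skp actR)) : (B2 ⊗[k] (B2 ⊗[k] (B2 ⊗[k] B1))) →ₗ[k] (B2 ⊗[k] (B2 ⊗[k] B2)))
      ∘ₗ ((skp swap2) : (B2 ⊗[k] (B2 ⊗[k] (B2 ⊗[k] B1))) →ₗ[k] (B2 ⊗[k] (B2 ⊗[k] (B2 ⊗[k] B1))))
      ∘ₗ ((merge2 actR) : (B2 ⊗[k] (B1 ⊗[k] (B2 ⊗[k] (B2 ⊗[k] B1)))) →ₗ[k] (B2 ⊗[k] (B2 ⊗[k] (B2 ⊗[k] B1))))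
      ∘ₗ ((skp (skp (skp coactL))) : (B2 ⊗[k] (B1 ⊗[k] (B2 ⊗[k] B1))) →ₗ[k] (B2 ⊗[k] (B1 ⊗[k] (B2 ⊗[k] (B2 ⊗[k] B1)))))
      ∘ₗ ((skp swap2) : (B2 ⊗[k] (B2 ⊗[k] (B1 ⊗[k] B1))) →ₗ[k] (B2 ⊗[k] (B1 ⊗[k] (B2 ⊗[k] B1))))
      ∘ₗ ((skp (skp delta1)) : (B2 ⊗[k] (B2 ⊗[k] B1)) →ₗ[k] (B2 ⊗[k] (B2 ⊗[k] (B1 ⊗[k] B1))))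
      ∘ₗ ((split2 delta2) : (B2 ⊗[k] B1) →ₗ[k] (B2 ⊗[k] (B2 ⊗[k] B1)))

noncomputable def ax_modCoalg2 (m1 : (B1 ⊗[k] B1) →ₗ[k] B1) (eta1 : k →ₗ[k] B1)
    (delta1 : B1 →ₗ[k] (B1 ⊗[k] B1)) (eps1 : B1 →ₗ[k] k)
    (m2 : (B2 ⊗[k] B2) →ₗ[k] B2) (eta2 : k →ₗ[k] B2)
    (delta2 : B2 →ₗ[k] (B2 ⊗[k] B2)) (eps2 : B2 →ₗ[k] k)
    (actL : (B2 ⊗[k] B1) →ₗ[k] B1) (coactL : B1 →ₗ[k] (B2 ⊗[k] B1))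
    (actR : (B2 ⊗[k] B1) →ₗ[k] B2) (coactR : B2 →ₗ[k] (B2 ⊗[k] B1)) : Prop :=
    (delta1 : B1 →ₗ[k] (B1 ⊗[k] B1))
      ∘ₗ (actL : (B2 ⊗[k] B1) →ₗ[k] B1)
    =
    ((skp m1) : (B1 ⊗[k] (B1 ⊗[k] B1)) →ₗ[k] (B1 ⊗[k] B1))
      ∘ₗ ((skp (skp actL)) : (B1 ⊗[k] (B1 ⊗[k] (B2 ⊗[k] B1))) →ₗ[k] (B1 ⊗[k] (B1 ⊗[k] B1)))
      ∘ₗ ((merge2 actL) : (B2 ⊗[k] (B1 ⊗[k] (B1 ⊗[k] (B2 ⊗[k] B1)))) →ₗ[k] (B1 ⊗[k] (B1 ⊗[k] (B2 ⊗[k] B1))))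
      ∘ₗ ((skp swap2) : (B2 ⊗[k] (B1 ⊗[k] (B1 ⊗[k] (B2 ⊗[k] B1)))) →ₗ[k] (B2 ⊗[k] (B1 ⊗[k] (B1 ⊗[k] (B2 ⊗[k] B1)))))
      ∘ₗ ((split2 coactR) : (B2 ⊗[k] (B1 ⊗[k] (B2 ⊗[k] B1))) →ₗ[k] (B2 ⊗[k] (B1 ⊗[k] (B1 ⊗[k] (B2 ⊗[k] B1)))))
      ∘ₗ ((skp swap2) : (B2 ⊗[k] (B2 ⊗[k] (B1 ⊗[k] B1))) →ₗ[k] (B2 ⊗[k] (B1 ⊗[k] (B2 ⊗[k] B1))))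
      ∘ₗ ((skp (skp delta1)) : (B2 ⊗[k] (B2 ⊗[k] B1)) →ₗ[k] (B2 ⊗[k] (B2 ⊗[k] (B1 ⊗[k] B1))))
      ∘ₗ ((split2 delta2) : (B2 ⊗[k] B1) →ₗ[k] (B2 ⊗[k] (B2 ⊗[k] B1)))

noncomputable def ax_comodAlg1 (m1 : (B1 ⊗[k] B1) →ₗ[k] B1) (eta1 : k →ₗ[k] B1)
    (delta1 : B1 →ₗ[k] (B1 ⊗[k] B1)) (eps1 : B1 →ₗ[k] k)
    (m2 : (B2 ⊗[k] B2) →ₗ[k] B2) (eta2 : k →ₗ[k] B2)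
    (delta2 : B2 →ₗ[k] (B2 ⊗[k] B2)) (eps2 : B2 →ₗ[k] k)
    (actL : (B2 ⊗[k] B1) →ₗ[k] B1) (coactL : B1 →ₗ[k] (B2 ⊗[k] B1))
    (actR : (B2 ⊗[k] B1) →ₗ[k] B2) (coactR : B2 →ₗ[k] (B2 ⊗[k] B1)) : Prop :=
    (coactR : B2 →ₗ[k] (B2 ⊗[k] B1))
      ∘ₗ (m2 : (B2 ⊗[k] B2) →ₗ[k] B2)
    =
    ((skp m1) : (B2 ⊗[k] (B1 ⊗[k] B1)) →ₗ[k] (B2 ⊗[k] B1))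
      ∘ₗ ((skp (skp actL)) : (B2 ⊗[k] (B1 ⊗[k] (B2 ⊗[k] B1))) →ₗ[k] (B2 ⊗[k] (B1 ⊗[k] B1)))
      ∘ₗ ((merge2 m2) : (B2 ⊗[k] (B2 ⊗[k] (B1 ⊗[k] (B2 ⊗[k] B1)))) →ₗ[k] (B2 ⊗[k] (B1 ⊗[k] (B2 ⊗[k] B1))))
      ∘ₗ ((skp swap2) : (B2 ⊗[k] (B1 ⊗[k] (B2 ⊗[k] (B2 ⊗[k] B1)))) →ₗ[k] (B2 ⊗[k] (B2 ⊗[k] (B1 ⊗[k] (B2 ⊗[k] B1)))))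
      ∘ₗ ((skp (skp swap2)) : (B2 ⊗[k] (B1 ⊗[k] (B2 ⊗[k] (B2 ⊗[k] B1)))) →ₗ[k] (B2 ⊗[k] (B1 ⊗[k] (B2 ⊗[k] (B2 ⊗[k] B1)))))
      ∘ₗ ((skp (skp (skp coactR))) : (B2 ⊗[k] (B1 ⊗[k] (B2 ⊗[k] B2))) →ₗ[k] (B2 ⊗[k] (B1 ⊗[k] (B2 ⊗[k] (B2 ⊗[k] B1)))))
      ∘ₗ ((split2 coactR) : (B2 ⊗[k] (B2 ⊗[k] B2)) →ₗ[k] (B2 ⊗[k] (B1 ⊗[k] (B2 ⊗[k] B2))))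
      ∘ₗ ((split2 delta2) : (B2 ⊗[k] B2) →ₗ[k] (B2 ⊗[k] (B2 ⊗[k] B2)))

noncomputable def ax_comodAlg2 (m1 : (B1 ⊗[k] B1) →ₗ[k] B1) (eta1 : k →ₗ[k] B1)
    (delta1 : B1 →ₗ[k] (B1 ⊗[k] B1)) (eps1 : B1 →ₗ[k] k)
    (m2 : (B2 ⊗[k] B2) →ₗ[k] B2) (eta2 : k →ₗ[k] B2)
    (delta2 : B2 →ₗ[k] (B2 ⊗[k] B2)) (eps2 : B2 →ₗ[k] k)
    (actL : (B2 ⊗[k] B1) →ₗ[k] B1) (coactL : B1 →ₗ[k] (B2 ⊗[k] B1))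
    (actR : (B2 ⊗[k] B1) →ₗ[k] B2) (coactR : B2 →ₗ[k] (B2 ⊗[k] B1)) : Prop :=
    (coactL : B1 →ₗ[k] (B2 ⊗[k] B1))
      ∘ₗ (m1 : (B1 ⊗[k] B1) →ₗ[k] B1)
    =
    ((skp m1) : (B2 ⊗[k] (B1 ⊗[k] B1)) →ₗ[k] (B2 ⊗[k] B1))
      ∘ₗ ((merge2 m2) : (B2 ⊗[k] (B2 ⊗[k] (B1 ⊗[k] B1))) →ₗ[k] (B2 ⊗[k] (B1 ⊗[k] B1)))
      ∘ₗ ((skp swap2) : (B2 ⊗[k] (B1 ⊗[k] (B2 ⊗[k] B1))) →ₗ[k] (B2 ⊗[k] (B2 ⊗[k] (B1 ⊗[k] B1))))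
      ∘ₗ ((skp (skp coactL)) : (B2 ⊗[k] (B1 ⊗[k] B1)) →ₗ[k] (B2 ⊗[k] (B1 ⊗[k] (B2 ⊗[k] B1))))
      ∘ₗ ((merge2 actR) : (B2 ⊗[k] (B1 ⊗[k] (B1 ⊗[k] B1))) →ₗ[k] (B2 ⊗[k] (B1 ⊗[k] B1)))
      ∘ₗ ((skp swap2) : (B2 ⊗[k] (B1 ⊗[k] (B1 ⊗[k] B1))) →ₗ[k] (B2 ⊗[k] (B1 ⊗[k] (B1 ⊗[k] B1))))
      ∘ₗ ((skp (skp delta1)) : (B2 ⊗[k] (B1 ⊗[k] B1)) →ₗ[k] (B2 ⊗[k] (B1 ⊗[k] (B1 ⊗[k] B1))))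
      ∘ₗ ((split2 coactL) : (B1 ⊗[k] B1) →ₗ[k] (B2 ⊗[k] (B1 ⊗[k] B1)))


/-- A Hopf datum in the sense of Definition 2.5 of Bespalov-Drabant,
"Cross Product Bialgebras I", in the symmetric monoidal category of `k`-modules:
two objects which are both (counital) algebras and (unital) coalgebras, `B1` a left
`B2`-module and -comodule, `B2` a right `B1`-module and -comodule, subject to the
algebra-coalgebra, module-comodule, module-algebra, comodule-coalgebra, module-coalgebra
and comodule-algebra compatibilities. -/
structure HopfDatum where
  m1 : (B1 ⊗[k] B1) →ₗ[k] B1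
  eta1 : k →ₗ[k] B1
  delta1 : B1 →ₗ[k] (B1 ⊗[k] B1)
  eps1 : B1 →ₗ[k] k
  m2 : (B2 ⊗[k] B2) →ₗ[k] B2
  eta2 : k →ₗ[k] B2
  delta2 : B2 →ₗ[k] (B2 ⊗[k] B2)
  eps2 : B2 →ₗ[k] k
  actL : (B2 ⊗[k] B1) →ₗ[k] B1
  coactL : B1 →ₗ[k] (B2 ⊗[k] B1)
  actR : (B2 ⊗[k] B1) →ₗ[k] B2
  coactR : B2 →ₗ[k] (B2 ⊗[k] B1)
  alg1 : IsAlgMaps k B1 m1 eta1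
  coalg1 : IsCoalgMaps k B1 delta1 eps1
  alg2 : IsAlgMaps k B2 m2 eta2
  coalg2 : IsCoalgMaps k B2 delta2 eps2
  epseta1 : eps1 ∘ₗ eta1 = LinearMap.id
  epseta2 : eps2 ∘ₗ eta2 = LinearMap.id
  actL_act : ax_actL_act k B1 B2 m1 eta1 delta1 eps1 m2 eta2 delta2 eps2 actL coactL actR coactR
  actL_unit : ax_actL_unit k B1 B2 m1 eta1 delta1 eps1 m2 eta2 delta2 eps2 actL coactL actR coactR
  actR_act : ax_actR_act k B1 B2 m1 eta1 delta1 eps1 m2 eta2 delta2 eps2 actL coactL actR coactR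
  actR_unit : ax_actR_unit k B1 B2 m1 eta1 delta1 eps1 m2 eta2 delta2 eps2 actL coactL actR coactR
  coactL_coact : ax_coactL_coact k B1 B2 m1 eta1 delta1 eps1 m2 eta2 delta2 eps2 actL coactL actR coactR
  coactL_counit : ax_coactL_counit k B1 B2 m1 eta1 delta1 eps1 m2 eta2 delta2 eps2 actL coactL actR coactR
  coactR_coact : ax_coactR_coact k B1 B2 m1 eta1 delta1 eps1 m2 eta2 delta2 eps2 actL coactL actR coactR
  coactR_counit : ax_coactR_counit k B1 B2 m1 eta1 delta1 eps1 m2 eta2 delta2 eps2 actL coactL actR coactR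
  actR_eta2 : ax_actR_eta2 k B1 B2 m1 eta1 delta1 eps1 m2 eta2 delta2 eps2 actL coactL actR coactR
  coactL_eps1 : ax_coactL_eps1 k B1 B2 m1 eta1 delta1 eps1 m2 eta2 delta2 eps2 actL coactL actR coactR
  eps2_actR : ax_eps2_actR k B1 B2 m1 eta1 delta1 eps1 m2 eta2 delta2 eps2 actL coactL actR coactR
  eps1_actL : ax_eps1_actL k B1 B2 m1 eta1 delta1 eps1 m2 eta2 delta2 eps2 actL coactL actR coactR
  actL_eta1 : ax_actL_eta1 k B1 B2 m1 eta1 delta1 eps1 m2 eta2 delta2 eps2 actL coactL actR coactR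
  coactR_eps2 : ax_coactR_eps2 k B1 B2 m1 eta1 delta1 eps1 m2 eta2 delta2 eps2 actL coactL actR coactR
  coactR_eta2 : ax_coactR_eta2 k B1 B2 m1 eta1 delta1 eps1 m2 eta2 delta2 eps2 actL coactL actR coactR
  coactL_eta1 : ax_coactL_eta1 k B1 B2 m1 eta1 delta1 eps1 m2 eta2 delta2 eps2 actL coactL actR coactR
  algCoalg1 : ax_algCoalg1 k B1 B2 m1 eta1 delta1 eps1 m2 eta2 delta2 eps2 actL coactL actR coactR
  algCoalg2 : ax_algCoalg2 k B1 B2 m1 eta1 delta1 eps1 m2 eta2 delta2 eps2 actL coactL actR coactR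
  modComod : ax_modComod k B1 B2 m1 eta1 delta1 eps1 m2 eta2 delta2 eps2 actL coactL actR coactR
  modAlg1 : ax_modAlg1 k B1 B2 m1 eta1 delta1 eps1 m2 eta2 delta2 eps2 actL coactL actR coactR
  modAlg2 : ax_modAlg2 k B1 B2 m1 eta1 delta1 eps1 m2 eta2 delta2 eps2 actL coactL actR coactR
  comodCoalg1 : ax_comodCoalg1 k B1 B2 m1 eta1 delta1 eps1 m2 eta2 delta2 eps2 actL coactL actR coactR
  comodCoalg2 : ax_comodCoalg2 k B1 B2 m1 eta1 delta1 eps1 m2 eta2 delta2 eps2 actL coactL actR coactR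
  modCoalg1 : ax_modCoalg1 k B1 B2 m1 eta1 delta1 eps1 m2 eta2 delta2 eps2 actL coactL actR coactR
  modCoalg2 : ax_modCoalg2 k B1 B2 m1 eta1 delta1 eps1 m2 eta2 delta2 eps2 actL coactL actR coactR
  comodAlg1 : ax_comodAlg1 k B1 B2 m1 eta1 delta1 eps1 m2 eta2 delta2 eps2 actL coactL actR coactR
  comodAlg2 : ax_comodAlg2 k B1 B2 m1 eta1 delta1 eps1 m2 eta2 delta2 eps2 actL coactL actR coactR

end HopfDatumSection


section Derived
variable {k : Type*} [CommRing k] {B1 B2 : Type*}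
  [AddCommMonoid B1] [Module k B1] [AddCommMonoid B2] [Module k B2]

/-- `φ₂₁ = (μ_l ⊗ μ_r) ∘ (id ⊗ τ ⊗ id) ∘ (Δ₂ ⊗ Δ₁)` -/
noncomputable def mpPhi21 (delta1 : B1 →ₗ[k] (B1 ⊗[k] B1)) (delta2 : B2 →ₗ[k] (B2 ⊗[k] B2))
    (actL : (B2 ⊗[k] B1) →ₗ[k] B1) (actR : (B2 ⊗[k] B1) →ₗ[k] B2) :
    (B2 ⊗[k] B1) →ₗ[k] (B1 ⊗[k] B2) :=
  ((skp actR) : (B1 ⊗[k] (B2 ⊗[k] B1)) →ₗ[k] (B1 ⊗[k] B2))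
      ∘ₗ ((merge2 actL) : (B2 ⊗[k] (B1 ⊗[k] (B2 ⊗[k] B1))) →ₗ[k] (B1 ⊗[k] (B2 ⊗[k] B1)))
      ∘ₗ ((skp swap2) : (B2 ⊗[k] (B2 ⊗[k] (B1 ⊗[k] B1))) →ₗ[k] (B2 ⊗[k] (B1 ⊗[k] (B2 ⊗[k] B1))))
      ∘ₗ ((skp (skp delta1)) : (B2 ⊗[k] (B2 ⊗[k] B1)) →ₗ[k] (B2 ⊗[k] (B2 ⊗[k] (B1 ⊗[k] B1))))
      ∘ₗ ((split2 delta2) : (B2 ⊗[k] B1) →ₗ[k] (B2 ⊗[k] (B2 ⊗[k] B1)))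

/-- `φ₁₂ = (m₂ ⊗ m₁) ∘ (id ⊗ τ ⊗ id) ∘ (ν_l ⊗ ν_r)` -/
noncomputable def mpPhi12 (m1 : (B1 ⊗[k] B1) →ₗ[k] B1) (m2 : (B2 ⊗[k] B2) →ₗ[k] B2)
    (coactL : B1 →ₗ[k] (B2 ⊗[k] B1)) (coactR : B2 →ₗ[k] (B2 ⊗[k] B1)) :
    (B1 ⊗[k] B2) →ₗ[k] (B2 ⊗[k] B1) :=
  ((skp m1) : (B2 ⊗[k] (B1 ⊗[k] B1)) →ₗ[k] (B2 ⊗[k] B1))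
      ∘ₗ ((merge2 m2) : (B2 ⊗[k] (B2 ⊗[k] (B1 ⊗[k] B1))) →ₗ[k] (B2 ⊗[k] (B1 ⊗[k] B1)))
      ∘ₗ ((skp swap2) : (B2 ⊗[k] (B1 ⊗[k] (B2 ⊗[k] B1))) →ₗ[k] (B2 ⊗[k] (B2 ⊗[k] (B1 ⊗[k] B1))))
      ∘ₗ ((skp (skp coactR)) : (B2 ⊗[k] (B1 ⊗[k] B2)) →ₗ[k] (B2 ⊗[k] (B1 ⊗[k] (B2 ⊗[k] B1))))
      ∘ₗ ((split2 coactL) : (B1 ⊗[k] B2) →ₗ[k] (B2 ⊗[k] (B1 ⊗[k] B2)))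


variable (hd : HopfDatum k B1 B2)

/-- the morphism `φ₂₁` canonically associated with a Hopf datum -/
noncomputable def hdPhi21 : (B2 ⊗[k] B1) →ₗ[k] (B1 ⊗[k] B2) :=
  mpPhi21 hd.delta1 hd.delta2 hd.actL hd.actR

/-- the morphism `φ₁₂` canonically associated with a Hopf datum -/
noncomputable def hdPhi12 : (B1 ⊗[k] B2) →ₗ[k] (B2 ⊗[k] B1) :=
  mpPhi12 hd.m1 hd.m2 hd.coactL hd.coactR

/-- the multiplication on `B₁ ⊗ B₂` associated with a Hopf datum (Proposition 2.6) -/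
noncomputable def hdMul : ((B1 ⊗[k] B2) ⊗[k] (B1 ⊗[k] B2)) →ₗ[k] (B1 ⊗[k] B2) :=
  crossMul hd.m1 hd.m2 (hdPhi21 hd)

/-- the unit on `B₁ ⊗ B₂` associated with a Hopf datum -/
noncomputable def hdUnit : k →ₗ[k] (B1 ⊗[k] B2) := crossUnit hd.eta1 hd.eta2

/-- the comultiplication on `B₁ ⊗ B₂` associated with a Hopf datum (Proposition 2.6) -/
noncomputable def hdComul : (B1 ⊗[k] B2) →ₗ[k] ((B1 ⊗[k] B2) ⊗[k] (B1 ⊗[k] B2)) :=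
  crossComul hd.delta1 hd.delta2 (hdPhi12 hd)

/-- the counit on `B₁ ⊗ B₂` associated with a Hopf datum -/
noncomputable def hdCounit : (B1 ⊗[k] B2) →ₗ[k] k := crossCounit hd.eps1 hd.eps2

/-- the idempotent `π = (η₁ ∘ ε₁) ⊗ id ⊗ id ⊗ (η₂ ∘ ε₂)` on `B₁ ⊗ B₂ ⊗ B₁ ⊗ B₂` -/
noncomputable def piMap : (B1 ⊗[k] (B2 ⊗[k] (B1 ⊗[k] B2))) →ₗ[k]
    (B1 ⊗[k] (B2 ⊗[k] (B1 ⊗[k] B2))) :=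
  TensorProduct.map (hd.eta1 ∘ₗ hd.eps1)
    (TensorProduct.map LinearMap.id (TensorProduct.map LinearMap.id (hd.eta2 ∘ₗ hd.eps2)))

/-- the recursion operator `Φ` of Definition 2.10 / eq. (2.11) of Bespalov-Drabant,
"Cross Product Bialgebras I", associated with a Hopf datum -/
noncomputable def Phi (f : (B1 ⊗[k] (B2 ⊗[k] (B1 ⊗[k] B2))) →ₗ[k]
    (B1 ⊗[k] (B2 ⊗[k] (B1 ⊗[k] B2)))) :
    (B1 ⊗[k] (B2 ⊗[k] (B1 ⊗[k] B2))) →ₗ[k] (B1 ⊗[k] (B2 ⊗[k] (B1 ⊗[k] B2))) :=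
  ((skp (skp (merge2 hd.m1))) : (B1 ⊗[k] (B2 ⊗[k] (B1 ⊗[k] (B1 ⊗[k] B2)))) →ₗ[k] (B1 ⊗[k] (B2 ⊗[k] (B1 ⊗[k] B2))))
      ∘ₗ ((skp (merge2 hd.m2)) : (B1 ⊗[k] (B2 ⊗[k] (B2 ⊗[k] (B1 ⊗[k] (B1 ⊗[k] B2))))) →ₗ[k] (B1 ⊗[k] (B2 ⊗[k] (B1 ⊗[k] (B1 ⊗[k] B2)))))
      ∘ₗ ((skp (skp (skp (skp (merge2 hd.m1))))) : (B1 ⊗[k] (B2 ⊗[k] (B2 ⊗[k] (B1 ⊗[k] (B1 ⊗[k] (B1 ⊗[k] B2)))))) →ₗ[k] (B1 ⊗[k] (B2 ⊗[k] (B2 ⊗[k] (B1 ⊗[k] (B1 ⊗[k] B2))))))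
      ∘ₗ ((skp (skp swap2)) : (B1 ⊗[k] (B2 ⊗[k] (B1 ⊗[k] (B2 ⊗[k] (B1 ⊗[k] (B1 ⊗[k] B2)))))) →ₗ[k] (B1 ⊗[k] (B2 ⊗[k] (B2 ⊗[k] (B1 ⊗[k] (B1 ⊗[k] (B1 ⊗[k] B2)))))))
      ∘ₗ ((skp (merge2 hd.m2)) : (B1 ⊗[k] (B2 ⊗[k] (B2 ⊗[k] (B1 ⊗[k] (B2 ⊗[k] (B1 ⊗[k] (B1 ⊗[k] B2))))))) →ₗ[k] (B1 ⊗[k] (B2 ⊗[k] (B1 ⊗[k] (B2 ⊗[k] (B1 ⊗[k] (B1 ⊗[k] B2)))))))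
      ∘ₗ ((skp (skp (skp (skp (skp (skp (merge2 hd.actL))))))) : (B1 ⊗[k] (B2 ⊗[k] (B2 ⊗[k] (B1 ⊗[k] (B2 ⊗[k] (B1 ⊗[k] (B2 ⊗[k] (B1 ⊗[k] B2)))))))) →ₗ[k] (B1 ⊗[k] (B2 ⊗[k] (B2 ⊗[k] (B1 ⊗[k] (B2 ⊗[k] (B1 ⊗[k] (B1 ⊗[k] B2))))))))
      ∘ₗ ((skp (skp (skp (skp swap2)))) : (B1 ⊗[k] (B2 ⊗[k] (B2 ⊗[k] (B1 ⊗[k] (B1 ⊗[k] (B2 ⊗[k] (B2 ⊗[k] (B1 ⊗[k] B2)))))))) →ₗ[k] (B1 ⊗[k] (B2 ⊗[k] (B2 ⊗[k] (B1 ⊗[k] (B2 ⊗[k] (B1 ⊗[k] (B2 ⊗[k] (B1 ⊗[k] B2)))))))))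
      ∘ₗ ((skp (skp swap2)) : (B1 ⊗[k] (B2 ⊗[k] (B1 ⊗[k] (B2 ⊗[k] (B1 ⊗[k] (B2 ⊗[k] (B2 ⊗[k] (B1 ⊗[k] B2)))))))) →ₗ[k] (B1 ⊗[k] (B2 ⊗[k] (B2 ⊗[k] (B1 ⊗[k] (B1 ⊗[k] (B2 ⊗[k] (B2 ⊗[k] (B1 ⊗[k] B2)))))))))
      ∘ₗ ((skp (merge2 hd.actR)) : (B1 ⊗[k] (B2 ⊗[k] (B1 ⊗[k] (B1 ⊗[k] (B2 ⊗[k] (B1 ⊗[k] (B2 ⊗[k] (B2 ⊗[k] (B1 ⊗[k] B2))))))))) →ₗ[k] (B1 ⊗[k] (B2 ⊗[k] (B1 ⊗[k] (B2 ⊗[k] (B1 ⊗[k] (B2 ⊗[k] (B2 ⊗[k] (B1 ⊗[k] B2)))))))))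
      ∘ₗ ((skp (skp (skp (skp (skp (skp (skp (skp (skp hd.m2))))))))) : (B1 ⊗[k] (B2 ⊗[k] (B1 ⊗[k] (B1 ⊗[k] (B2 ⊗[k] (B1 ⊗[k] (B2 ⊗[k] (B2 ⊗[k] (B1 ⊗[k] (B2 ⊗[k] B2)))))))))) →ₗ[k] (B1 ⊗[k] (B2 ⊗[k] (B1 ⊗[k] (B1 ⊗[k] (B2 ⊗[k] (B1 ⊗[k] (B2 ⊗[k] (B2 ⊗[k] (B1 ⊗[k] B2))))))))))
      ∘ₗ ((skp (skp (skp (skp (skp (skp swap2)))))) : (B1 ⊗[k] (B2 ⊗[k] (B1 ⊗[k] (B1 ⊗[k] (B2 ⊗[k] (B1 ⊗[k] (B2 ⊗[k] (B2 ⊗[k] (B1 ⊗[k] (B2 ⊗[k] B2)))))))))) →ₗ[k] (B1 ⊗[k] (B2 ⊗[k] (B1 ⊗[k] (B1 ⊗[k] (B2 ⊗[k] (B1 ⊗[k] (B2 ⊗[k] (B2 ⊗[k] (B1 ⊗[k] (B2 ⊗[k] B2)))))))))))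
      ∘ₗ ((skp (skp swap2)) : (B1 ⊗[k] (B2 ⊗[k] (B1 ⊗[k] (B1 ⊗[k] (B2 ⊗[k] (B1 ⊗[k] (B2 ⊗[k] (B2 ⊗[k] (B1 ⊗[k] (B2 ⊗[k] B2)))))))))) →ₗ[k] (B1 ⊗[k] (B2 ⊗[k] (B1 ⊗[k] (B1 ⊗[k] (B2 ⊗[k] (B1 ⊗[k] (B2 ⊗[k] (B2 ⊗[k] (B1 ⊗[k] (B2 ⊗[k] B2)))))))))))
      ∘ₗ ((merge2 hd.m1) : (B1 ⊗[k] (B1 ⊗[k] (B2 ⊗[k] (B1 ⊗[k] (B1 ⊗[k] (B2 ⊗[k] (B1 ⊗[k] (B2 ⊗[k] (B2 ⊗[k] (B1 ⊗[k] (B2 ⊗[k] B2))))))))))) →ₗ[k] (B1 ⊗[k] (B2 ⊗[k] (B1 ⊗[k] (B1 ⊗[k] (B2 ⊗[k] (B1 ⊗[k] (B2 ⊗[k] (B2 ⊗[k] (B1 ⊗[k] (B2 ⊗[k] B2)))))))))))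
      ∘ₗ ((skp (skp (skp (skp (skp (skp (skp (skp (skp (skp (merge2 hd.actR))))))))))) : (B1 ⊗[k] (B1 ⊗[k] (B2 ⊗[k] (B1 ⊗[k] (B1 ⊗[k] (B2 ⊗[k] (B1 ⊗[k] (B2 ⊗[k] (B2 ⊗[k] (B1 ⊗[k] (B2 ⊗[k] (B1 ⊗[k] B2)))))))))))) →ₗ[k] (B1 ⊗[k] (B1 ⊗[k] (B2 ⊗[k] (B1 ⊗[k] (B1 ⊗[k] (B2 ⊗[k] (B1 ⊗[k] (B2 ⊗[k] (B2 ⊗[k] (B1 ⊗[k] (B2 ⊗[k] B2))))))))))))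
      ∘ₗ ((skp (skp (skp (skp (skp (skp (skp (skp (split2 hd.coactR))))))))) : (B1 ⊗[k] (B1 ⊗[k] (B2 ⊗[k] (B1 ⊗[k] (B1 ⊗[k] (B2 ⊗[k] (B1 ⊗[k] (B2 ⊗[k] (B2 ⊗[k] (B2 ⊗[k] (B1 ⊗[k] B2))))))))))) →ₗ[k] (B1 ⊗[k] (B1 ⊗[k] (B2 ⊗[k] (B1 ⊗[k] (B1 ⊗[k] (B2 ⊗[k] (B1 ⊗[k] (B2 ⊗[k] (B2 ⊗[k] (B1 ⊗[k] (B2 ⊗[k] (B1 ⊗[k] B2)))))))))))))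
      ∘ₗ ((skp (skp (split2 hd.coactL))) : (B1 ⊗[k] (B1 ⊗[k] (B1 ⊗[k] (B1 ⊗[k] (B2 ⊗[k] (B1 ⊗[k] (B2 ⊗[k] (B2 ⊗[k] (B2 ⊗[k] (B1 ⊗[k] B2)))))))))) →ₗ[k] (B1 ⊗[k] (B1 ⊗[k] (B2 ⊗[k] (B1 ⊗[k] (B1 ⊗[k] (B2 ⊗[k] (B1 ⊗[k] (B2 ⊗[k] (B2 ⊗[k] (B2 ⊗[k] (B1 ⊗[k] B2))))))))))))
      ∘ₗ ((skp (merge2 hd.actL)) : (B1 ⊗[k] (B2 ⊗[k] (B1 ⊗[k] (B1 ⊗[k] (B1 ⊗[k] (B2 ⊗[k] (B1 ⊗[k] (B2 ⊗[k] (B2 ⊗[k] (B2 ⊗[k] (B1 ⊗[k] B2))))))))))) →ₗ[k] (B1 ⊗[k] (B1 ⊗[k] (B1 ⊗[k] (B1 ⊗[k] (B2 ⊗[k] (B1 ⊗[k] (B2 ⊗[k] (B2 ⊗[k] (B2 ⊗[k] (B1 ⊗[k] B2)))))))))))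
      ∘ₗ ((skp (skp (skp (skp (skp (skp (skp (skp swap2)))))))) : (B1 ⊗[k] (B2 ⊗[k] (B1 ⊗[k] (B1 ⊗[k] (B1 ⊗[k] (B2 ⊗[k] (B1 ⊗[k] (B2 ⊗[k] (B2 ⊗[k] (B2 ⊗[k] (B1 ⊗[k] B2))))))))))) →ₗ[k] (B1 ⊗[k] (B2 ⊗[k] (B1 ⊗[k] (B1 ⊗[k] (B1 ⊗[k] (B2 ⊗[k] (B1 ⊗[k] (B2 ⊗[k] (B2 ⊗[k] (B2 ⊗[k] (B1 ⊗[k] B2))))))))))))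
      ∘ₗ ((skp (skp (skp (skp (apply4 f))))) : (B1 ⊗[k] (B2 ⊗[k] (B1 ⊗[k] (B1 ⊗[k] (B1 ⊗[k] (B2 ⊗[k] (B1 ⊗[k] (B2 ⊗[k] (B2 ⊗[k] (B2 ⊗[k] (B1 ⊗[k] B2))))))))))) →ₗ[k] (B1 ⊗[k] (B2 ⊗[k] (B1 ⊗[k] (B1 ⊗[k] (B1 ⊗[k] (B2 ⊗[k] (B1 ⊗[k] (B2 ⊗[k] (B2 ⊗[k] (B2 ⊗[k] (B1 ⊗[k] B2))))))))))))
      ∘ₗ ((skp (skp swap2)) : (B1 ⊗[k] (B2 ⊗[k] (B1 ⊗[k] (B1 ⊗[k] (B1 ⊗[k] (B2 ⊗[k] (B1 ⊗[k] (B2 ⊗[k] (B2 ⊗[k] (B2 ⊗[k] (B1 ⊗[k] B2))))))))))) →ₗ[k] (B1 ⊗[k] (B2 ⊗[k] (B1 ⊗[k] (B1 ⊗[k] (B1 ⊗[k] (B2 ⊗[k] (B1 ⊗[k] (B2 ⊗[k] (B2 ⊗[k] (B2 ⊗[k] (B1 ⊗[k] B2))))))))))))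
      ∘ₗ ((skp (skp (skp (skp (skp (skp (skp (skp (skp (split2 hd.coactR)))))))))) : (B1 ⊗[k] (B2 ⊗[k] (B1 ⊗[k] (B1 ⊗[k] (B1 ⊗[k] (B2 ⊗[k] (B1 ⊗[k] (B2 ⊗[k] (B2 ⊗[k] (B2 ⊗[k] B2)))))))))) →ₗ[k] (B1 ⊗[k] (B2 ⊗[k] (B1 ⊗[k] (B1 ⊗[k] (B1 ⊗[k] (B2 ⊗[k] (B1 ⊗[k] (B2 ⊗[k] (B2 ⊗[k] (B2 ⊗[k] (B1 ⊗[k] B2))))))))))))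
      ∘ₗ ((skp (skp (skp (skp (skp (skp (skp (skp (merge2 hd.actR))))))))) : (B1 ⊗[k] (B2 ⊗[k] (B1 ⊗[k] (B1 ⊗[k] (B1 ⊗[k] (B2 ⊗[k] (B1 ⊗[k] (B2 ⊗[k] (B2 ⊗[k] (B1 ⊗[k] (B2 ⊗[k] B2))))))))))) →ₗ[k] (B1 ⊗[k] (B2 ⊗[k] (B1 ⊗[k] (B1 ⊗[k] (B1 ⊗[k] (B2 ⊗[k] (B1 ⊗[k] (B2 ⊗[k] (B2 ⊗[k] (B2 ⊗[k] B2)))))))))))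
      ∘ₗ ((skp (skp (skp (merge2 hd.actL)))) : (B1 ⊗[k] (B2 ⊗[k] (B1 ⊗[k] (B2 ⊗[k] (B1 ⊗[k] (B1 ⊗[k] (B2 ⊗[k] (B1 ⊗[k] (B2 ⊗[k] (B2 ⊗[k] (B1 ⊗[k] (B2 ⊗[k] B2)))))))))))) →ₗ[k] (B1 ⊗[k] (B2 ⊗[k] (B1 ⊗[k] (B1 ⊗[k] (B1 ⊗[k] (B2 ⊗[k] (B1 ⊗[k] (B2 ⊗[k] (B2 ⊗[k] (B1 ⊗[k] (B2 ⊗[k] B2))))))))))))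
      ∘ₗ ((skp (split2 hd.coactL)) : (B1 ⊗[k] (B1 ⊗[k] (B2 ⊗[k] (B1 ⊗[k] (B1 ⊗[k] (B2 ⊗[k] (B1 ⊗[k] (B2 ⊗[k] (B2 ⊗[k] (B1 ⊗[k] (B2 ⊗[k] B2))))))))))) →ₗ[k] (B1 ⊗[k] (B2 ⊗[k] (B1 ⊗[k] (B2 ⊗[k] (B1 ⊗[k] (B1 ⊗[k] (B2 ⊗[k] (B1 ⊗[k] (B2 ⊗[k] (B2 ⊗[k] (B1 ⊗[k] (B2 ⊗[k] B2)))))))))))))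
      ∘ₗ ((skp (skp (skp (skp (skp (skp (skp (skp (skp (skp hd.delta2)))))))))) : (B1 ⊗[k] (B1 ⊗[k] (B2 ⊗[k] (B1 ⊗[k] (B1 ⊗[k] (B2 ⊗[k] (B1 ⊗[k] (B2 ⊗[k] (B2 ⊗[k] (B1 ⊗[k] B2)))))))))) →ₗ[k] (B1 ⊗[k] (B1 ⊗[k] (B2 ⊗[k] (B1 ⊗[k] (B1 ⊗[k] (B2 ⊗[k] (B1 ⊗[k] (B2 ⊗[k] (B2 ⊗[k] (B1 ⊗[k] (B2 ⊗[k] B2))))))))))))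
      ∘ₗ ((skp (skp (skp (skp (skp (skp (skp swap2))))))) : (B1 ⊗[k] (B1 ⊗[k] (B2 ⊗[k] (B1 ⊗[k] (B1 ⊗[k] (B2 ⊗[k] (B1 ⊗[k] (B2 ⊗[k] (B2 ⊗[k] (B1 ⊗[k] B2)))))))))) →ₗ[k] (B1 ⊗[k] (B1 ⊗[k] (B2 ⊗[k] (B1 ⊗[k] (B1 ⊗[k] (B2 ⊗[k] (B1 ⊗[k] (B2 ⊗[k] (B2 ⊗[k] (B1 ⊗[k] B2)))))))))))
      ∘ₗ ((skp (skp (skp swap2))) : (B1 ⊗[k] (B1 ⊗[k] (B2 ⊗[k] (B1 ⊗[k] (B1 ⊗[k] (B2 ⊗[k] (B1 ⊗[k] (B2 ⊗[k] (B2 ⊗[k] (B1 ⊗[k] B2)))))))))) →ₗ[k] (B1 ⊗[k] (B1 ⊗[k] (B2 ⊗[k] (B1 ⊗[k] (B1 ⊗[k] (B2 ⊗[k] (B1 ⊗[k] (B2 ⊗[k] (B2 ⊗[k] (B1 ⊗[k] B2)))))))))))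
      ∘ₗ ((split2 hd.delta1) : (B1 ⊗[k] (B2 ⊗[k] (B1 ⊗[k] (B1 ⊗[k] (B2 ⊗[k] (B1 ⊗[k] (B2 ⊗[k] (B2 ⊗[k] (B1 ⊗[k] B2))))))))) →ₗ[k] (B1 ⊗[k] (B1 ⊗[k] (B2 ⊗[k] (B1 ⊗[k] (B1 ⊗[k] (B2 ⊗[k] (B1 ⊗[k] (B2 ⊗[k] (B2 ⊗[k] (B1 ⊗[k] B2)))))))))))
      ∘ₗ ((skp (skp (skp (skp (skp (skp (skp (split2 hd.coactL)))))))) : (B1 ⊗[k] (B2 ⊗[k] (B1 ⊗[k] (B1 ⊗[k] (B2 ⊗[k] (B1 ⊗[k] (B2 ⊗[k] (B1 ⊗[k] B2)))))))) →ₗ[k] (B1 ⊗[k] (B2 ⊗[k] (B1 ⊗[k] (B1 ⊗[k] (B2 ⊗[k] (B1 ⊗[k] (B2 ⊗[k] (B2 ⊗[k] (B1 ⊗[k] B2))))))))))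
      ∘ₗ ((skp (skp (skp (skp (skp swap2))))) : (B1 ⊗[k] (B2 ⊗[k] (B1 ⊗[k] (B1 ⊗[k] (B2 ⊗[k] (B2 ⊗[k] (B1 ⊗[k] (B1 ⊗[k] B2)))))))) →ₗ[k] (B1 ⊗[k] (B2 ⊗[k] (B1 ⊗[k] (B1 ⊗[k] (B2 ⊗[k] (B1 ⊗[k] (B2 ⊗[k] (B1 ⊗[k] B2)))))))))
      ∘ₗ ((skp (skp (skp swap2))) : (B1 ⊗[k] (B2 ⊗[k] (B1 ⊗[k] (B2 ⊗[k] (B1 ⊗[k] (B2 ⊗[k] (B1 ⊗[k] (B1 ⊗[k] B2)))))))) →ₗ[k] (B1 ⊗[k] (B2 ⊗[k] (B1 ⊗[k] (B1 ⊗[k] (B2 ⊗[k] (B2 ⊗[k] (B1 ⊗[k] (B1 ⊗[k] B2)))))))))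
      ∘ₗ ((skp (split2 hd.coactR)) : (B1 ⊗[k] (B2 ⊗[k] (B2 ⊗[k] (B1 ⊗[k] (B2 ⊗[k] (B1 ⊗[k] (B1 ⊗[k] B2))))))) →ₗ[k] (B1 ⊗[k] (B2 ⊗[k] (B1 ⊗[k] (B2 ⊗[k] (B1 ⊗[k] (B2 ⊗[k] (B1 ⊗[k] (B1 ⊗[k] B2)))))))))
      ∘ₗ ((skp (skp (skp (skp (skp (split2 hd.delta1)))))) : (B1 ⊗[k] (B2 ⊗[k] (B2 ⊗[k] (B1 ⊗[k] (B2 ⊗[k] (B1 ⊗[k] B2)))))) →ₗ[k] (B1 ⊗[k] (B2 ⊗[k] (B2 ⊗[k] (B1 ⊗[k] (B2 ⊗[k] (B1 ⊗[k] (B1 ⊗[k] B2))))))))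
      ∘ₗ ((skp (skp (skp swap2))) : (B1 ⊗[k] (B2 ⊗[k] (B2 ⊗[k] (B2 ⊗[k] (B1 ⊗[k] (B1 ⊗[k] B2)))))) →ₗ[k] (B1 ⊗[k] (B2 ⊗[k] (B2 ⊗[k] (B1 ⊗[k] (B2 ⊗[k] (B1 ⊗[k] B2)))))))
      ∘ₗ ((skp (split2 hd.delta2)) : (B1 ⊗[k] (B2 ⊗[k] (B2 ⊗[k] (B1 ⊗[k] (B1 ⊗[k] B2))))) →ₗ[k] (B1 ⊗[k] (B2 ⊗[k] (B2 ⊗[k] (B2 ⊗[k] (B1 ⊗[k] (B1 ⊗[k] B2)))))))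
      ∘ₗ ((skp (skp (skp (split2 hd.delta1)))) : (B1 ⊗[k] (B2 ⊗[k] (B2 ⊗[k] (B1 ⊗[k] B2)))) →ₗ[k] (B1 ⊗[k] (B2 ⊗[k] (B2 ⊗[k] (B1 ⊗[k] (B1 ⊗[k] B2))))))
      ∘ₗ ((skp (split2 hd.delta2)) : (B1 ⊗[k] (B2 ⊗[k] (B1 ⊗[k] B2))) →ₗ[k] (B1 ⊗[k] (B2 ⊗[k] (B2 ⊗[k] (B1 ⊗[k] B2)))))

end Derived

end CPB


/-
Overview of the proof.

Write A for the first bialgebra and B for the second one, h.a for the left action of h in B on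
a in A, and h<a for the right action of a on h. The exchange map of the double cross product is
phi(h, a) = sum (h1 . a1) (x) (h2 < a2), and the product of two elementary tensors is obtained by
moving h past b with phi and then multiplying separately in each factor.

A direct Sweedler computation of associativity has to juggle up to five-fold iterated coproducts,
which is painful when everything is phrased through linear maps between nested tensor products.
Instead the argument below is organised around one categorical principle:

  a morphism of coalgebras into a tensor product of two coalgebras is completely determined by its
  two marginals, where a marginal means postcomposing with the counit of the other factor.

Indeed, if F is such a morphism and c is an element of its source, then comultiplicativity shows
that F(c) is recovered from the coproduct of c by applying the first marginal of F on the left leg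
and the second marginal on the right leg. No cocommutativity is needed for this uniqueness. What
does require an extra hypothesis is existence: given coalgebra morphisms f and g with a common
source, the convolution (f (x) g) after the coproduct respects comultiplication exactly because
the images of f and g commute in the twisted sense. For the pair formed by the two actions,
that hypothesis is the last compatibility axiom of a matched pair.

The steps are therefore as follows.

Step 1. Each structure map occurring in the theorem (both products, both units, both actions)
is packaged as a bundled coalgebra morphism. For the actions this uses the module coalgebra axioms,
for products and units it uses that we started with bialgebras.

Step 2. By the existence half of the principle, phi is itself a coalgebra morphism. Its marginals
are the left action and the right action, thanks to the counit axioms.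

Step 3. The product on the tensor product is a composite of coalgebra morphisms (associators,
phi, and the two given products). Hence multiplicativity of the new coproduct and counit comes
for free, with no computation whatsoever.

Step 4. Associativity is equivalent to two distributive laws, describing how phi interacts with
a product in B in its first slot and with a product in A in its second slot. Both sides of each
law are coalgebra morphisms with values in A (x) B, so by uniqueness it suffices to compare their
marginals. One marginal of the first law is the module axiom for the left action, while the other
one is the first matched pair identity. Symmetrically, the second law reduces to the module axiom
for the right action together with the second matched pair identity.

Step 5. The unit laws are handled in the same manner: phi(1, a) and a (x) 1 are two coalgebra
morphisms of a, and their marginals agree by unitality of the left action and by the normalisation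
condition saying that acting on the unit element is the same as applying the counit.

Step 6. What remains is bookkeeping. The frozen statement describes all maps as vertical composites
of operations on a right-nested list of strands, so a few lemmas translate these diagrams into the
usual formulas built from the middle four interchange.
-/

namespace DCP
open Coalgebra

set_option linter.unusedSectionVars false
set_option linter.unusedSimpArgs false
set_option linter.flexible false

section General
variable {k : Type*} [CommRing k] {C A B : Type*}
  [AddCommGroup C] [Module k C] [Coalgebra k C]
  [AddCommGroup A] [Module k A] [Coalgebra k A]
  [AddCommGroup B] [Module k B] [Coalgebra k B]

/-- The four-fold coproduct can be computed either by splitting both legs of the coproduct, or by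
splitting the right leg three ways. This is the only place where coassociativity is used directly;
the second form isolates the two middle legs, which are the ones that have to be exchanged. -/
theorem comul4 (c : C) :
    TensorProduct.assoc k C C (C ⊗[k] C)
      (TensorProduct.map comul comul (comul (R := k) c)) =
    TensorProduct.map LinearMap.id
      ((TensorProduct.assoc k C C C).toLinearMap ∘ₗ
        TensorProduct.map comul LinearMap.id ∘ₗ comul) (comul (R := k) c) := by
  have h1 : (TensorProduct.assoc k C C C).toLinearMap ∘ₗ
        TensorProduct.map comul LinearMap.id ∘ₗ comul =
        TensorProduct.map LinearMap.id comul ∘ₗ comul (R := k) (A := C) := Coalgebra.coassoc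
  have h2 : ∀ y : C ⊗[k] C, TensorProduct.assoc k C C (C ⊗[k] C)
      (TensorProduct.map comul comul y) =
      TensorProduct.map LinearMap.id (TensorProduct.map LinearMap.id comul)
        (TensorProduct.assoc k C C C (TensorProduct.map comul LinearMap.id y)) := by
    intro y
    induction y with
    | zero => simp
    | add a b ha hb => simp only [map_add, ha, hb]
    | tmul u v =>
      simp only [TensorProduct.map_tmul, LinearMap.id_apply]
      generalize comul (R := k) u = z
      induction z with
      | zero => simp
      | add a b ha hb => simp only [map_add, TensorProduct.add_tmul, ha, hb]
      | tmul p q => simp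
  rw [h2, h1]
  have h3 := LinearMap.congr_fun h1 c
  simp only [LinearMap.comp_apply, LinearEquiv.coe_coe] at h3
  rw [h3]
  rw [← LinearMap.comp_apply, ← TensorProduct.map_comp, LinearMap.comp_id]

/-- Element form of the statement that a convolution of two commuting coalgebra maps is again
comultiplicative. After rewriting with `comul4` the outer legs are inert, and the inner two legs are
precisely an instance of the commutation hypothesis `h`. -/
theorem conv_comul (L : C →ₗ[k] A) (R : C →ₗ[k] B)
    (h : TensorProduct.map R L ∘ₗ comul =
      (TensorProduct.comm k A B).toLinearMap ∘ₗ TensorProduct.map L R ∘ₗ comul) (c : C) :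
    TensorProduct.map (TensorProduct.map L R) (TensorProduct.map L R)
      (TensorProduct.map comul comul (comul (R := k) c)) =
    TensorProduct.tensorTensorTensorComm k A A B B
      (TensorProduct.map (TensorProduct.map L L) (TensorProduct.map R R)
      (TensorProduct.map comul comul (comul (R := k) c))) := by
  have h4 := comul4 (k := k) c
  rw [← LinearEquiv.eq_symm_apply] at h4
  rw [h4]
  generalize comul (R := k) c = y
  induction y with
  | zero => simp
  | add a b ha hb => simp only [map_add, ha, hb]
  | tmul u v =>
    simp only [TensorProduct.map_tmul, LinearMap.id_apply, LinearMap.comp_apply]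
    generalize comul (R := k) v = y
    induction y with
    | zero => simp
    | add a b ha hb => simp only [map_add, TensorProduct.tmul_add, ha, hb]
    | tmul v w =>
      simp only [TensorProduct.map_tmul, LinearMap.id_apply, LinearEquiv.coe_coe]
      let E : B ⊗[k] A →ₗ[k] (A ⊗[k] B) ⊗[k] (A ⊗[k] B) :=
        TensorProduct.map (TensorProduct.mk k A B (L u)) ((TensorProduct.mk k A B).flip (R w))
      have hv := congrArg E (LinearMap.congr_fun h v)
      simp only [LinearMap.comp_apply] at hv
      convert hv using 1
      · generalize comul (R := k) v = y
        induction y with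
        | zero => simp
        | add a b ha hb => simp only [map_add, TensorProduct.tmul_add, TensorProduct.add_tmul, ha, hb]
        | tmul p q => simp [E]
      · generalize comul (R := k) v = y
        induction y with
        | zero => simp
        | add a b ha hb => simp only [map_add, TensorProduct.tmul_add, TensorProduct.add_tmul, ha, hb]
        | tmul p q => simp [E]

/-- the coalgebra morphism `(L ⊗ R) ∘ Δ` -/
noncomputable def convHom (L : C →ₗc[k] A) (R : C →ₗc[k] B)
    (h : TensorProduct.map R.toLinearMap L.toLinearMap ∘ₗ comul =
      (TensorProduct.comm k A B).toLinearMap ∘ₗ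
        TensorProduct.map L.toLinearMap R.toLinearMap ∘ₗ comul) : C →ₗc[k] A ⊗[k] B where
  toLinearMap := TensorProduct.map L.toLinearMap R.toLinearMap ∘ₗ comul
  counit_comp := by
    ext c
    have hy : ∀ y : C ⊗[k] C,
        counit (R := k) (TensorProduct.map L.toLinearMap R.toLinearMap y) =
        counit (R := k) (TensorProduct.lid k C (counit.rTensor C y)) := by
      intro y
      induction y with
      | zero => simp
      | add a b ha hb => simp only [map_add, ha, hb]
      | tmul p q => simp [mul_comm]
    have := hy (comul c)
    rw [Coalgebra.rTensor_counit_comul] at this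
    simpa using this
  map_comp_comul := by
    ext c
    have h1 := conv_comul L.toLinearMap R.toLinearMap h c
    have h2 : ∀ y : C ⊗[k] C,
      TensorProduct.tensorTensorTensorComm k A A B B
      (TensorProduct.map (TensorProduct.map L.toLinearMap L.toLinearMap)
        (TensorProduct.map R.toLinearMap R.toLinearMap)
      (TensorProduct.map comul comul y)) =
      comul (R := k) (TensorProduct.map L.toLinearMap R.toLinearMap y) := by
      intro y
      induction y with
      | zero => simp
      | add a b ha hb => simp only [map_add, ha, hb]
      | tmul p q =>
        have e1 := LinearMap.congr_fun L.map_comp_comul p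
        have e2 := LinearMap.congr_fun R.map_comp_comul q
        simp only [LinearMap.comp_apply] at e1 e2
        simp only [TensorProduct.map_tmul, e1, e2]
        rfl
    rw [h2] at h1
    rw [LinearMap.comp_apply, LinearMap.comp_apply, LinearMap.comp_apply, ← h1,
      TensorProduct.map_comp, LinearMap.comp_apply]

/-- first projection -/
noncomputable def pr1 : A ⊗[k] B →ₗ[k] A :=
  (TensorProduct.rid k A).toLinearMap ∘ₗ TensorProduct.map LinearMap.id counit

/-- second projection -/
noncomputable def pr2 : A ⊗[k] B →ₗ[k] B :=
  (TensorProduct.lid k B).toLinearMap ∘ₗ TensorProduct.map counit LinearMap.id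

/-- Value of the first marginal on a pure tensor. -/
@[simp] theorem pr1_tmul (a : A) (b : B) :
    pr1 (a ⊗ₜ[k] b) = counit (R := k) b • a := by simp [pr1]

/-- Value of the second marginal on a pure tensor. -/
@[simp] theorem pr2_tmul (a : A) (b : B) :
    pr2 (a ⊗ₜ[k] b) = counit (R := k) a • b := by simp [pr2]

/-- Splitting an element of a tensor product coalgebra and then keeping only the left half of the
first copy and the right half of the second copy gives back the element we began with. -/
theorem pr_comul (x : A ⊗[k] B) :
    TensorProduct.map pr1 pr2 (comul (R := k) x) = x := by
  induction x with
  | zero => simp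
  | add a b ha hb => simp only [map_add, ha, hb]
  | tmul a b =>
    have hab : ∀ (y : A ⊗[k] A) (z : B ⊗[k] B), TensorProduct.map pr1 pr2
      (TensorProduct.tensorTensorTensorComm k A A B B (y ⊗ₜ[k] z)) =
      TensorProduct.rid k A (counit.lTensor A y) ⊗ₜ[k]
        TensorProduct.lid k B (counit.rTensor B z) := by
      intro y z
      induction y with
      | zero => simp
      | add a b ha hb => simp only [map_add, TensorProduct.add_tmul, ha, hb]
      | tmul p q =>
        induction z with
        | zero => simp
        | add a b ha hb => simp only [map_add, TensorProduct.tmul_add, ha, hb]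
        | tmul r s =>
          simp [TensorProduct.smul_tmul', TensorProduct.tmul_smul, smul_smul, mul_comm]
    have := hab (comul a) (comul b)
    rw [Coalgebra.lTensor_counit_comul, Coalgebra.rTensor_counit_comul] at this
    simp only [TensorProduct.rid_tmul, TensorProduct.lid_tmul, one_smul] at this
    exact this

/-- Uniqueness: coalgebra morphisms into a tensor product agree once their marginals agree. -/
theorem hom_ext (F G : C →ₗc[k] A ⊗[k] B)
    (h1 : ∀ c, pr1 (F c) = pr1 (G c)) (h2 : ∀ c, pr2 (F c) = pr2 (G c)) (c : C) :
    F c = G c := by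
  have key : ∀ H : C →ₗc[k] A ⊗[k] B, H c =
      TensorProduct.map (pr1 ∘ₗ H.toLinearMap) (pr2 ∘ₗ H.toLinearMap) (comul (R := k) c) := by
    intro H
    have e := LinearMap.congr_fun H.map_comp_comul c
    simp only [LinearMap.comp_apply] at e
    rw [TensorProduct.map_comp, LinearMap.comp_apply, e, pr_comul]
    rfl
  have e1 : pr1 ∘ₗ F.toLinearMap = pr1 ∘ₗ G.toLinearMap := LinearMap.ext h1
  have e2 : pr2 ∘ₗ F.toLinearMap = pr2 ∘ₗ G.toLinearMap := LinearMap.ext h2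
  rw [key F, key G, e1, e2]

/-- Discarding the right output of a convolution leaves the left constituent. -/
theorem pr1_conv (L : C →ₗc[k] A) (R : C →ₗc[k] B) (h) (c : C) :
    pr1 (convHom L R h c) = L c := by
  have hy : ∀ y : C ⊗[k] C, pr1 (TensorProduct.map L.toLinearMap R.toLinearMap y) =
      L (TensorProduct.rid k C (counit.lTensor C y)) := by
    intro y
    induction y with
    | zero => simp
    | add a b ha hb => simp only [map_add, ha, hb]
    | tmul p q => simp
  have := hy (comul c)
  rw [Coalgebra.lTensor_counit_comul] at this
  simp only [TensorProduct.rid_tmul, TensorProduct.lid_tmul, one_smul] at this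
  exact this

/-- Discarding the left output of a convolution leaves the right constituent. -/
theorem pr2_conv (L : C →ₗc[k] A) (R : C →ₗc[k] B) (h) (c : C) :
    pr2 (convHom L R h c) = R c := by
  have hy : ∀ y : C ⊗[k] C, pr2 (TensorProduct.map L.toLinearMap R.toLinearMap y) =
      R (TensorProduct.lid k C (counit.rTensor C y)) := by
    intro y
    induction y with
    | zero => simp
    | add a b ha hb => simp only [map_add, ha, hb]
    | tmul p q => simp
  have := hy (comul c)
  rw [Coalgebra.rTensor_counit_comul] at this
  simp only [TensorProduct.rid_tmul, TensorProduct.lid_tmul, one_smul] at this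
  exact this

end General

section Matched
variable {k : Type*} [CommRing k] {A B : Type*}
  [AddCommGroup A] [Module k A] [Coalgebra k A]
  [AddCommGroup B] [Module k B] [Coalgebra k B]

/-- the product coalgebra morphism `(m₁ ⊗ m₂) ∘ (id ⊗ φ ⊗ id)` -/
noncomputable def mulHom (mA : A ⊗[k] A →ₗc[k] A) (mB : B ⊗[k] B →ₗc[k] B)
    (p : B ⊗[k] A →ₗc[k] A ⊗[k] B) :
    (A ⊗[k] B) ⊗[k] (A ⊗[k] B) →ₗc[k] A ⊗[k] B :=
  (Coalgebra.TensorProduct.map mA mB).comp <|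
    ((Coalgebra.TensorProduct.assoc k k A A (B ⊗[k] B)).symm.toCoalgHom).comp <|
    (Coalgebra.TensorProduct.map (CoalgHom.id k A)
      (((Coalgebra.TensorProduct.assoc k k A B B).toCoalgHom).comp <|
        (Coalgebra.TensorProduct.map p (CoalgHom.id k B)).comp
          (Coalgebra.TensorProduct.assoc k k B A B).symm.toCoalgHom)).comp
    (Coalgebra.TensorProduct.assoc k k A B (A ⊗[k] B)).toCoalgHom

/-- `a · x · g` for `x` in `A ⊗ B` -/
noncomputable def biact (mA : A ⊗[k] A →ₗ[k] A) (mB : B ⊗[k] B →ₗ[k] B) (a : A) (g : B) :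
    A ⊗[k] B →ₗ[k] A ⊗[k] B :=
  TensorProduct.map (mA ∘ₗ TensorProduct.mk k A A a) (mB ∘ₗ (TensorProduct.mk k B B).flip g)

/-- On elementary tensors the bundled product first exchanges the inner pair and afterwards lets the
outer pair act from the two sides. All the bundled associators evaluate definitionally. -/
theorem mulHom_tmul (mA : A ⊗[k] A →ₗc[k] A) (mB : B ⊗[k] B →ₗc[k] B)
    (p : B ⊗[k] A →ₗc[k] A ⊗[k] B) (a b : A) (h g : B) :
    mulHom mA mB p ((a ⊗ₜ[k] h) ⊗ₜ[k] (b ⊗ₜ[k] g)) =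
      biact mA.toLinearMap mB.toLinearMap a g (p (h ⊗ₜ[k] b)) := by
  have e : mulHom mA mB p ((a ⊗ₜ[k] h) ⊗ₜ[k] (b ⊗ₜ[k] g)) =
    TensorProduct.map mA.toLinearMap mB.toLinearMap
      ((TensorProduct.assoc k A A (B ⊗[k] B)).symm
        (a ⊗ₜ[k] (TensorProduct.assoc k A B B (p (h ⊗ₜ[k] b) ⊗ₜ[k] g)))) := rfl
  rw [e]
  generalize p (h ⊗ₜ[k] b) = y
  induction y with
  | zero => simp
  | add a b ha hb => simp only [map_add, TensorProduct.add_tmul, TensorProduct.tmul_add, ha, hb]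
  | tmul u v => simp [biact]

/-- the distributive law implies associativity -/
theorem assoc_of_distrib (mA : A ⊗[k] A →ₗ[k] A) (mB : B ⊗[k] B →ₗ[k] B)
    (assocA : ∀ a b c, mA (mA (a ⊗ₜ b) ⊗ₜ c) = mA (a ⊗ₜ mA (b ⊗ₜ c)))
    (assocB : ∀ a b c, mB (mB (a ⊗ₜ b) ⊗ₜ c) = mB (a ⊗ₜ mB (b ⊗ₜ c)))
    (p : B ⊗[k] A →ₗ[k] A ⊗[k] B)
    (mul : (A ⊗[k] B) ⊗[k] (A ⊗[k] B) →ₗ[k] A ⊗[k] B)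
    (hmul : ∀ a h b g, mul ((a ⊗ₜ[k] h) ⊗ₜ[k] (b ⊗ₜ[k] g)) = biact mA mB a g (p (h ⊗ₜ b)))
    (d1 : ∀ h g c, p (mB (h ⊗ₜ g) ⊗ₜ c) =
      TensorProduct.map LinearMap.id mB (TensorProduct.assoc k A B B
        (TensorProduct.map p LinearMap.id ((TensorProduct.assoc k B A B).symm
          (h ⊗ₜ p (g ⊗ₜ c))))))
    (d2 : ∀ h b c, p (h ⊗ₜ mA (b ⊗ₜ c)) =
      TensorProduct.map mA LinearMap.id ((TensorProduct.assoc k A A B).symm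
        (TensorProduct.map LinearMap.id p (TensorProduct.assoc k A B A
          (p (h ⊗ₜ b) ⊗ₜ c)))))
    (x y z : A ⊗[k] B) :
    mul (mul (x ⊗ₜ y) ⊗ₜ z) = mul (x ⊗ₜ mul (y ⊗ₜ z)) := by
  induction x with
  | zero => simp
  | add a b ha hb => simp only [map_add, TensorProduct.add_tmul, ha, hb]
  | tmul a h =>
  induction y with
  | zero => simp
  | add a b ha hb => simp only [map_add, TensorProduct.add_tmul, TensorProduct.tmul_add, ha, hb]
  | tmul b g =>
  induction z with
  | zero => simp
  | add a b ha hb => simp only [map_add, TensorProduct.tmul_add, ha, hb]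
  | tmul c f =>
  rw [hmul, hmul]
  have l1 : ∀ X : A ⊗[k] B, mul (biact mA mB a g X ⊗ₜ (c ⊗ₜ f)) =
      biact mA mB a f (TensorProduct.map mA mB
       ((TensorProduct.assoc k A A (B ⊗[k] B)).symm
        (TensorProduct.map LinearMap.id ((TensorProduct.assoc k A B B).toLinearMap ∘ₗ
        TensorProduct.map p LinearMap.id ∘ₗ (TensorProduct.assoc k B A B).symm.toLinearMap)
        (TensorProduct.assoc k A B (A ⊗[k] B) (X ⊗ₜ p (g ⊗ₜ c)))))) := by
    intro X
    induction X with
    | zero => simp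
    | add a b ha hb => simp only [map_add, TensorProduct.add_tmul, ha, hb]
    | tmul u v =>
      simp only [biact, TensorProduct.map_tmul, LinearMap.comp_apply, TensorProduct.mk_apply,
        LinearMap.flip_apply]
      rw [hmul, d1]
      generalize p (g ⊗ₜ c) = Y
      induction Y with
      | zero => simp
      | add a b ha hb => simp only [map_add, TensorProduct.tmul_add, ha, hb]
      | tmul r s =>
        simp only [TensorProduct.assoc_symm_tmul, TensorProduct.assoc_tmul,
          TensorProduct.map_tmul, LinearMap.comp_apply, LinearEquiv.coe_coe, LinearMap.id_apply]
        generalize p (v ⊗ₜ r) = Z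
        induction Z with
        | zero => simp
        | add a b ha hb => simp only [map_add, TensorProduct.add_tmul, TensorProduct.tmul_add, ha, hb]
        | tmul m n => simp [biact, assocA, assocB]
  have l2 : ∀ Y : A ⊗[k] B, mul ((a ⊗ₜ h) ⊗ₜ biact mA mB b f Y) =
      biact mA mB a f (TensorProduct.map mA mB
       ((TensorProduct.assoc k A A (B ⊗[k] B)).symm
        (TensorProduct.map LinearMap.id ((TensorProduct.assoc k A B B).toLinearMap ∘ₗ
        TensorProduct.map p LinearMap.id ∘ₗ (TensorProduct.assoc k B A B).symm.toLinearMap)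
        (TensorProduct.assoc k A B (A ⊗[k] B) (p (h ⊗ₜ b) ⊗ₜ Y))))) := by
    intro Y
    induction Y with
    | zero => simp
    | add a b ha hb => simp only [map_add, TensorProduct.tmul_add, ha, hb]
    | tmul u v =>
      simp only [biact, TensorProduct.map_tmul, LinearMap.comp_apply, TensorProduct.mk_apply,
        LinearMap.flip_apply]
      rw [hmul, d2]
      generalize p (h ⊗ₜ b) = X
      induction X with
      | zero => simp
      | add a b ha hb => simp only [map_add, TensorProduct.add_tmul, ha, hb]
      | tmul r s =>
        simp only [TensorProduct.assoc_symm_tmul, TensorProduct.assoc_tmul,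
          TensorProduct.map_tmul, LinearMap.comp_apply, LinearEquiv.coe_coe, LinearMap.id_apply]
        generalize p (s ⊗ₜ u) = Z
        induction Z with
        | zero => simp
        | add a b ha hb => simp only [map_add, TensorProduct.add_tmul, TensorProduct.tmul_add, ha, hb]
        | tmul m n => simp [biact, assocA, assocB]
  rw [l1, l2]

/-- First distributive law: moving a product of two elements of `B` past an element of `A` is the
same as moving them one after another. Verified on marginals. -/
theorem distrib1 (mA : A ⊗[k] A →ₗc[k] A) (mB : B ⊗[k] B →ₗc[k] B)
    (L : B ⊗[k] A →ₗc[k] A) (R : B ⊗[k] A →ₗc[k] B)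
    (p : B ⊗[k] A →ₗc[k] A ⊗[k] B) (hp1 : ∀ c, pr1 (p c) = L c) (hp2 : ∀ c, pr2 (p c) = R c)
    (hL : ∀ h g a, L (mB (h ⊗ₜ g) ⊗ₜ a) = L (h ⊗ₜ L (g ⊗ₜ a)))
    (hR : ∀ h g a, R (mB (h ⊗ₜ g) ⊗ₜ a) =
      mB (TensorProduct.map R.toLinearMap LinearMap.id
        ((TensorProduct.assoc k B A B).symm (h ⊗ₜ p (g ⊗ₜ a)))))
    (h g : B) (c : A) : p (mB (h ⊗ₜ g) ⊗ₜ c) =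
      TensorProduct.map LinearMap.id mB.toLinearMap (TensorProduct.assoc k A B B
        (TensorProduct.map p.toLinearMap LinearMap.id ((TensorProduct.assoc k B A B).symm
          (h ⊗ₜ p (g ⊗ₜ c))))) := by
  let F : B ⊗[k] (B ⊗[k] A) →ₗc[k] A ⊗[k] B :=
    p.comp ((Coalgebra.TensorProduct.map mB (CoalgHom.id k A)).comp
      (Coalgebra.TensorProduct.assoc k k B B A).symm.toCoalgHom)
  let G : B ⊗[k] (B ⊗[k] A) →ₗc[k] A ⊗[k] B :=
    (Coalgebra.TensorProduct.map (CoalgHom.id k A) mB).comp <|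
    ((Coalgebra.TensorProduct.assoc k k A B B).toCoalgHom).comp <|
    (Coalgebra.TensorProduct.map p (CoalgHom.id k B)).comp <|
    ((Coalgebra.TensorProduct.assoc k k B A B).symm.toCoalgHom).comp <|
    Coalgebra.TensorProduct.map (CoalgHom.id k B) p
  have hF : ∀ h g c, F (h ⊗ₜ (g ⊗ₜ c)) = p (mB (h ⊗ₜ g) ⊗ₜ c) := fun _ _ _ => rfl
  have hG : ∀ h g c, G (h ⊗ₜ (g ⊗ₜ c)) =
      TensorProduct.map LinearMap.id mB.toLinearMap (TensorProduct.assoc k A B B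
        (TensorProduct.map p.toLinearMap LinearMap.id ((TensorProduct.assoc k B A B).symm
          (h ⊗ₜ p (g ⊗ₜ c))))) := fun _ _ _ => rfl
  rw [← hF, ← hG]
  apply hom_ext
  · intro x
    induction x with
    | zero => simp
    | add a b ha hb => simp only [map_add, ha, hb]
    | tmul h y =>
    induction y with
    | zero => simp
    | add a b ha hb => simp only [map_add, TensorProduct.tmul_add, ha, hb]
    | tmul g c =>
      rw [hF, hG, hp1, hL, ← hp1 (g ⊗ₜ c)]
      generalize p (g ⊗ₜ c) = X
      induction X with
      | zero => simp
      | add a b ha hb => simp only [map_add, TensorProduct.tmul_add, ha, hb]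
      | tmul r s =>
        simp only [TensorProduct.assoc_symm_tmul, TensorProduct.map_tmul, pr1_tmul,
          TensorProduct.tmul_smul, map_smul, ← hp1]
        simp only [CoalgHom.toLinearMap_eq_coe, CoalgHom.coe_toLinearMap, LinearMap.id_apply]
        generalize p (h ⊗ₜ r) = Z
        induction Z with
        | zero => simp
        | add a b ha hb => simp only [map_add, TensorProduct.add_tmul, smul_add, ha, hb]
        | tmul m n => simp [smul_smul, mul_comm]
  · intro x
    induction x with
    | zero => simp
    | add a b ha hb => simp only [map_add, ha, hb]
    | tmul h y =>
    induction y with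
    | zero => simp
    | add a b ha hb => simp only [map_add, TensorProduct.tmul_add, ha, hb]
    | tmul g c =>
      rw [hF, hG, hp2, hR]
      generalize p (g ⊗ₜ c) = X
      induction X with
      | zero => simp
      | add a b ha hb => simp only [map_add, TensorProduct.tmul_add, ha, hb]
      | tmul r s =>
        simp only [TensorProduct.assoc_symm_tmul, TensorProduct.map_tmul]
        simp only [CoalgHom.toLinearMap_eq_coe, CoalgHom.coe_toLinearMap, LinearMap.id_apply, ← hp2]
        generalize p (h ⊗ₜ r) = Z
        induction Z with
        | zero => simp
        | add a b ha hb => simp only [map_add, TensorProduct.add_tmul, ha, hb]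
        | tmul m n =>
          simp
          rw [← TensorProduct.smul_tmul', map_smul]

/-- Second distributive law, the mirror image of `distrib1`: an element of `B` passes a product in
`A` by crossing its factors successively. -/
theorem distrib2 (mA : A ⊗[k] A →ₗc[k] A) (mB : B ⊗[k] B →ₗc[k] B)
    (L : B ⊗[k] A →ₗc[k] A) (R : B ⊗[k] A →ₗc[k] B)
    (p : B ⊗[k] A →ₗc[k] A ⊗[k] B) (hp1 : ∀ c, pr1 (p c) = L c) (hp2 : ∀ c, pr2 (p c) = R c)
    (hR : ∀ h a b, R (h ⊗ₜ mA (a ⊗ₜ b)) = R (R (h ⊗ₜ a) ⊗ₜ b))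
    (hL : ∀ h a b, L (h ⊗ₜ mA (a ⊗ₜ b)) =
      mA (TensorProduct.map LinearMap.id L.toLinearMap
        (TensorProduct.assoc k A B A (p (h ⊗ₜ a) ⊗ₜ b))))
    (h : B) (b c : A) : p (h ⊗ₜ mA (b ⊗ₜ c)) =
      TensorProduct.map mA.toLinearMap LinearMap.id ((TensorProduct.assoc k A A B).symm
        (TensorProduct.map LinearMap.id p.toLinearMap (TensorProduct.assoc k A B A
          (p (h ⊗ₜ b) ⊗ₜ c)))) := by
  let F : (B ⊗[k] A) ⊗[k] A →ₗc[k] A ⊗[k] B :=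
    p.comp ((Coalgebra.TensorProduct.map (CoalgHom.id k B) mA).comp
      (Coalgebra.TensorProduct.assoc k k B A A).toCoalgHom)
  let G : (B ⊗[k] A) ⊗[k] A →ₗc[k] A ⊗[k] B :=
    (Coalgebra.TensorProduct.map mA (CoalgHom.id k B)).comp <|
    ((Coalgebra.TensorProduct.assoc k k A A B).symm.toCoalgHom).comp <|
    (Coalgebra.TensorProduct.map (CoalgHom.id k A) p).comp <|
    ((Coalgebra.TensorProduct.assoc k k A B A).toCoalgHom).comp <|
    Coalgebra.TensorProduct.map p (CoalgHom.id k A)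
  have hF : ∀ h g c, F ((h ⊗ₜ g) ⊗ₜ c) = p (h ⊗ₜ mA (g ⊗ₜ c)) := fun _ _ _ => rfl
  have hG : ∀ h b c, G ((h ⊗ₜ b) ⊗ₜ c) =
      TensorProduct.map mA.toLinearMap LinearMap.id ((TensorProduct.assoc k A A B).symm
        (TensorProduct.map LinearMap.id p.toLinearMap (TensorProduct.assoc k A B A
          (p (h ⊗ₜ b) ⊗ₜ c)))) := fun _ _ _ => rfl
  rw [← hF, ← hG]
  apply hom_ext
  · intro x
    induction x with
    | zero => simp
    | add a b ha hb => simp only [map_add, ha, hb]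
    | tmul y c =>
    induction y with
    | zero => simp
    | add a b ha hb => simp only [map_add, TensorProduct.add_tmul, ha, hb]
    | tmul h b =>
      rw [hF, hG, hp1, hL]
      generalize p (h ⊗ₜ b) = X
      induction X with
      | zero => simp
      | add a b ha hb => simp only [map_add, TensorProduct.add_tmul, ha, hb]
      | tmul r s =>
        simp only [TensorProduct.assoc_tmul, TensorProduct.map_tmul]
        simp only [CoalgHom.toLinearMap_eq_coe, CoalgHom.coe_toLinearMap, LinearMap.id_apply, ← hp1]
        generalize p (s ⊗ₜ c) = Z
        induction Z with
        | zero => simp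
        | add a b ha hb => simp only [map_add, TensorProduct.tmul_add, ha, hb]
        | tmul m n =>
          simp
  · intro x
    induction x with
    | zero => simp
    | add a b ha hb => simp only [map_add, ha, hb]
    | tmul y c =>
    induction y with
    | zero => simp
    | add a b ha hb => simp only [map_add, TensorProduct.add_tmul, ha, hb]
    | tmul h b =>
      rw [hF, hG, hp2, hR, ← hp2 (h ⊗ₜ b)]
      generalize p (h ⊗ₜ b) = X
      induction X with
      | zero => simp
      | add a b ha hb => simp only [map_add, TensorProduct.add_tmul, ha, hb]
      | tmul r s =>
        simp only [TensorProduct.assoc_tmul, TensorProduct.map_tmul, pr2_tmul,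
          ← TensorProduct.smul_tmul', map_smul, ← hp2]
        simp only [CoalgHom.toLinearMap_eq_coe, CoalgHom.coe_toLinearMap, LinearMap.id_apply]
        generalize p (s ⊗ₜ c) = Z
        induction Z with
        | zero => simp
        | add a b ha hb => simp only [map_add, TensorProduct.tmul_add, smul_add, ha, hb]
        | tmul m n => simp [smul_smul, mul_comm]

/-- The unit of `B` slides freely past every element of `A`. -/
theorem phi_one_left (eB : k →ₗc[k] B)
    (L : B ⊗[k] A →ₗc[k] A) (R : B ⊗[k] A →ₗc[k] B)
    (p : B ⊗[k] A →ₗc[k] A ⊗[k] B) (hp1 : ∀ c, pr1 (p c) = L c) (hp2 : ∀ c, pr2 (p c) = R c)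
    (hL : ∀ a, L (eB 1 ⊗ₜ a) = a) (hR : ∀ a, R (eB 1 ⊗ₜ a) = counit (R := k) a • eB 1) (a : A) :
    p (eB 1 ⊗ₜ a) = a ⊗ₜ eB 1 := by
  let F : A →ₗc[k] A ⊗[k] B :=
    (p.comp (Coalgebra.TensorProduct.map eB (CoalgHom.id k A))).comp
      (Coalgebra.TensorProduct.lid k A).symm.toCoalgHom
  let G : A →ₗc[k] A ⊗[k] B :=
    (Coalgebra.TensorProduct.map (CoalgHom.id k A) eB).comp
      (Coalgebra.TensorProduct.rid k k A).symm.toCoalgHom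
  have hF : ∀ a, F a = p (eB 1 ⊗ₜ a) := fun _ => rfl
  have hG : ∀ a, G a = a ⊗ₜ eB 1 := fun _ => rfl
  have he : counit (R := k) (eB 1) = 1 := by simp
  rw [← hF, ← hG]
  apply hom_ext
  · intro c; rw [hF, hG, hp1, hL, pr1_tmul, he, one_smul]
  · intro c; rw [hF, hG, hp2, hR, pr2_tmul]

/-- Every element of `B` slides freely past the unit of `A`. -/
theorem phi_one_right (eA : k →ₗc[k] A)
    (L : B ⊗[k] A →ₗc[k] A) (R : B ⊗[k] A →ₗc[k] B)
    (p : B ⊗[k] A →ₗc[k] A ⊗[k] B) (hp1 : ∀ c, pr1 (p c) = L c) (hp2 : ∀ c, pr2 (p c) = R c)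
    (hR : ∀ h, R (h ⊗ₜ eA 1) = h) (hL : ∀ h, L (h ⊗ₜ eA 1) = counit (R := k) h • eA 1) (h : B) :
    p (h ⊗ₜ eA 1) = eA 1 ⊗ₜ h := by
  let F : B →ₗc[k] A ⊗[k] B :=
    (p.comp (Coalgebra.TensorProduct.map (CoalgHom.id k B) eA)).comp
      (Coalgebra.TensorProduct.rid k k B).symm.toCoalgHom
  let G : B →ₗc[k] A ⊗[k] B :=
    (Coalgebra.TensorProduct.map eA (CoalgHom.id k B)).comp
      (Coalgebra.TensorProduct.lid k B).symm.toCoalgHom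
  have hF : ∀ h, F h = p (h ⊗ₜ eA 1) := fun _ => rfl
  have hG : ∀ h, G h = eA 1 ⊗ₜ h := fun _ => rfl
  have he : counit (R := k) (eA 1) = 1 := by simp
  rw [← hF, ← hG]
  apply hom_ext
  · intro c; rw [hF, hG, hp1, hL, pr1_tmul]
  · intro c; rw [hF, hG, hp2, hR, pr2_tmul, he, one_smul]

end Matched

section Bridge
open CPB
variable {k : Type*} [Field k] {B1 B2 : Type*}
  [AddCommGroup B1] [Module k B1] [AddCommGroup B2] [Module k B2]

/-- Functoriality of tensoring with an idle strand on the far left. -/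
theorem skp_comp {A R R' R'' : Type*} [AddCommGroup A] [Module k A] [AddCommGroup R] [Module k R]
    [AddCommGroup R'] [Module k R'] [AddCommGroup R''] [Module k R'']
    (f : R' →ₗ[k] R'') (g : R →ₗ[k] R') :
    (skp (A := A) f) ∘ₗ skp g = skp (f ∘ₗ g) := by
  simp only [skp]
  rw [← TensorProduct.map_comp, LinearMap.comp_id]

/-- the string-diagram form of `(g ⊗ f) ∘ Δ` on `B₂ ⊗ B₁` -/
theorem strand_eq {X Y : Type*} [AddCommGroup X] [Module k X] [AddCommGroup Y] [Module k Y]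
    (g : (B2 ⊗[k] B1) →ₗ[k] X) (f : (B2 ⊗[k] B1) →ₗ[k] Y)
    (delta1 : B1 →ₗ[k] (B1 ⊗[k] B1)) (delta2 : B2 →ₗ[k] (B2 ⊗[k] B2)) :
    ((skp f) : (X ⊗[k] (B2 ⊗[k] B1)) →ₗ[k] (X ⊗[k] Y))
        ∘ₗ ((merge2 g) : (B2 ⊗[k] (B1 ⊗[k] (B2 ⊗[k] B1))) →ₗ[k] (X ⊗[k] (B2 ⊗[k] B1)))
        ∘ₗ ((skp swap2) : (B2 ⊗[k] (B2 ⊗[k] (B1 ⊗[k] B1))) →ₗ[k] (B2 ⊗[k] (B1 ⊗[k] (B2 ⊗[k] B1))))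
        ∘ₗ ((skp (skp delta1)) : (B2 ⊗[k] (B2 ⊗[k] B1)) →ₗ[k] (B2 ⊗[k] (B2 ⊗[k] (B1 ⊗[k] B1))))
        ∘ₗ ((split2 delta2) : (B2 ⊗[k] B1) →ₗ[k] (B2 ⊗[k] (B2 ⊗[k] B1))) =
    TensorProduct.map g f ∘ₗ (TensorProduct.tensorTensorTensorComm k B2 B2 B1 B1).toLinearMap ∘ₗ
      TensorProduct.map delta2 delta1 := by
  ext h a
  simp only [split2, TensorProduct.AlgebraTensorModule.curry_apply, LinearMap.restrictScalars_self,
    TensorProduct.curry_apply, LinearMap.comp_apply, TensorProduct.map_tmul, LinearMap.id_apply]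
  generalize delta2 h = Z
  induction Z with
  | zero => simp
  | add a b ha hb => simp only [map_add, TensorProduct.add_tmul, ha, hb]
  | tmul u v =>
    simp only [skp, LinearEquiv.coe_coe, TensorProduct.assoc_tmul, TensorProduct.map_tmul,
      LinearMap.id_apply]
    generalize delta1 a = W
    induction W with
    | zero => simp
    | add a b ha hb => simp only [map_add, TensorProduct.tmul_add, ha, hb]
    | tmul s t => simp [swap2, pair2, merge2]

/-- Translation of the right-hand side of the second matched pair identity, where an additional
spectator strand runs along on the right until the final action is carried out. -/
theorem strand3_eq (actL : (B2 ⊗[k] B1) →ₗ[k] B1) (actR : (B2 ⊗[k] B1) →ₗ[k] B2)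
    (delta1 : B1 →ₗ[k] (B1 ⊗[k] B1)) (delta2 : B2 →ₗ[k] (B2 ⊗[k] B2)) (h : B2) (a b : B1) :
    (((skp actL) : (B1 ⊗[k] (B2 ⊗[k] B1)) →ₗ[k] (B1 ⊗[k] B1))
        ∘ₗ ((skp (merge2 actR)) : (B1 ⊗[k] (B2 ⊗[k] (B1 ⊗[k] B1))) →ₗ[k] (B1 ⊗[k] (B2 ⊗[k] B1)))
        ∘ₗ ((merge2 actL) : (B2 ⊗[k] (B1 ⊗[k] (B2 ⊗[k] (B1 ⊗[k] B1)))) →ₗ[k] (B1 ⊗[k] (B2 ⊗[k] (B1 ⊗[k] B1))))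
        ∘ₗ ((skp swap2) : (B2 ⊗[k] (B2 ⊗[k] (B1 ⊗[k] (B1 ⊗[k] B1)))) →ₗ[k] (B2 ⊗[k] (B1 ⊗[k] (B2 ⊗[k] (B1 ⊗[k] B1)))))
        ∘ₗ ((skp (skp (split2 delta1))) : (B2 ⊗[k] (B2 ⊗[k] (B1 ⊗[k] B1))) →ₗ[k] (B2 ⊗[k] (B2 ⊗[k] (B1 ⊗[k] (B1 ⊗[k] B1)))))
        ∘ₗ ((split2 delta2) : (B2 ⊗[k] (B1 ⊗[k] B1)) →ₗ[k] (B2 ⊗[k] (B2 ⊗[k] (B1 ⊗[k] B1)))))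
        (h ⊗ₜ (a ⊗ₜ b)) =
    TensorProduct.map LinearMap.id actL (TensorProduct.assoc k B1 B2 B1
      ((TensorProduct.map actL actR ∘ₗ
        (TensorProduct.tensorTensorTensorComm k B2 B2 B1 B1).toLinearMap ∘ₗ
        TensorProduct.map delta2 delta1) (h ⊗ₜ a) ⊗ₜ b)) := by
  simp only [split2, LinearMap.comp_apply, TensorProduct.map_tmul, LinearMap.id_apply]
  generalize delta2 h = Z
  induction Z with
  | zero => simp
  | add a b ha hb => simp only [map_add, TensorProduct.add_tmul, ha, hb]
  | tmul u v =>
    simp only [skp, LinearEquiv.coe_coe, TensorProduct.assoc_tmul, TensorProduct.map_tmul,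
      LinearMap.id_apply, LinearMap.comp_apply]
    generalize delta1 a = W
    induction W with
    | zero => simp
    | add a b ha hb => simp only [map_add, TensorProduct.tmul_add, TensorProduct.add_tmul, ha, hb]
    | tmul s t => simp [swap2, pair2, merge2]

/-- The strand description of the cross product multiplication agrees with the bimodule
description used in the abstract part of the argument. -/
theorem crossMul_tmul (m1 : (B1 ⊗[k] B1) →ₗ[k] B1) (m2 : (B2 ⊗[k] B2) →ₗ[k] B2)
    (phi : (B2 ⊗[k] B1) →ₗ[k] (B1 ⊗[k] B2)) (a b : B1) (h g : B2) :
    crossMul m1 m2 phi ((a ⊗ₜ[k] h) ⊗ₜ[k] (b ⊗ₜ[k] g)) = biact m1 m2 a g (phi (h ⊗ₜ b)) := by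
  simp only [crossMul, pair2, skp, LinearMap.comp_apply, LinearEquiv.coe_coe,
    TensorProduct.assoc_tmul, TensorProduct.map_tmul, TensorProduct.assoc_symm_tmul,
    LinearMap.id_apply]
  generalize phi (h ⊗ₜ b) = Z
  induction Z with
  | zero => simp
  | add a b ha hb => simp only [map_add, TensorProduct.add_tmul, TensorProduct.tmul_add, ha, hb]
  | tmul u v => simp [merge2, biact]

/-- With the plain flip as exchange map, the cross coproduct is nothing but the standard tensor
product coproduct. -/
theorem crossComul_eq (delta1 : B1 →ₗ[k] (B1 ⊗[k] B1)) (delta2 : B2 →ₗ[k] (B2 ⊗[k] B2)) :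
    crossComul delta1 delta2 (TensorProduct.comm k B1 B2).toLinearMap =
    (TensorProduct.tensorTensorTensorComm k B1 B1 B2 B2).toLinearMap ∘ₗ
      TensorProduct.map delta1 delta2 := by
  ext a h
  simp only [crossComul, split2, TensorProduct.AlgebraTensorModule.curry_apply,
    LinearMap.restrictScalars_self,
    TensorProduct.curry_apply, LinearMap.comp_apply, TensorProduct.map_tmul, LinearMap.id_apply]
  generalize delta1 a = Z
  induction Z with
  | zero => simp
  | add a b ha hb => simp only [map_add, TensorProduct.add_tmul, ha, hb]
  | tmul u v =>
    simp only [skp, LinearEquiv.coe_coe, TensorProduct.assoc_tmul, TensorProduct.map_tmul,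
      LinearMap.id_apply]
    generalize delta2 h = W
    induction W with
    | zero => simp
    | add a b ha hb => simp only [map_add, TensorProduct.tmul_add, ha, hb]
    | tmul s t => simp [pair2]

/-- a `Coalgebra` instance from coalgebra structure maps -/
@[reducible] noncomputable def toCoalgebra {M : Type*} [AddCommGroup M] [Module k M]
    {comul : M →ₗ[k] (M ⊗[k] M)} {counit : M →ₗ[k] k} (h : IsCoalgMaps k M comul counit) :
    Coalgebra k M where
  comul := comul
  counit := counit
  coassoc := h.coassoc
  rTensor_counit_comp_comul := by
    ext x
    apply (TensorProduct.lid k M).injective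
    simpa [LinearMap.rTensor] using LinearMap.congr_fun h.counit_left x
  lTensor_counit_comp_comul := by
    ext x
    apply (TensorProduct.rid k M).injective
    simpa [LinearMap.lTensor] using LinearMap.congr_fun h.counit_right x

/-- coalgebra structure maps from a `Coalgebra` instance -/
theorem isCoalgMaps_of (M : Type*) [AddCommGroup M] [Module k M] [Coalgebra k M] :
    IsCoalgMaps k M Coalgebra.comul Coalgebra.counit where
  coassoc := Coalgebra.coassoc
  counit_left := by
    ext x
    have := Coalgebra.rTensor_counit_comul (R := k) x
    rw [LinearMap.comp_apply, LinearMap.comp_apply]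
    erw [this]
    simp
  counit_right := by
    ext x
    have := Coalgebra.lTensor_counit_comul (R := k) x
    rw [LinearMap.comp_apply, LinearMap.comp_apply]
    erw [this]
    simp

end Bridge

section Main
open CPB
variable {k : Type*} [Field k] {B1 B2 : Type*}
  [AddCommGroup B1] [Module k B1] [Coalgebra k B1] [AddCommGroup B2] [Module k B2] [Coalgebra k B2]

/-- assembling the double cross product from coalgebra morphisms -/
theorem assemble (mA : B1 ⊗[k] B1 →ₗc[k] B1) (mB : B2 ⊗[k] B2 →ₗc[k] B2)
    (eA : k →ₗc[k] B1) (eB : k →ₗc[k] B2)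
    (algA : IsAlgMaps k B1 mA.toLinearMap eA.toLinearMap)
    (algB : IsAlgMaps k B2 mB.toLinearMap eB.toLinearMap)
    (L : B2 ⊗[k] B1 →ₗc[k] B1) (R : B2 ⊗[k] B1 →ₗc[k] B2)
    (p : B2 ⊗[k] B1 →ₗc[k] B1 ⊗[k] B2) (hp1 : ∀ c, pr1 (p c) = L c) (hp2 : ∀ c, pr2 (p c) = R c)
    (hL : ∀ h g a, L (mB (h ⊗ₜ g) ⊗ₜ a) = L (h ⊗ₜ L (g ⊗ₜ a)))
    (hR : ∀ h g a, R (mB (h ⊗ₜ g) ⊗ₜ a) =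
      mB (TensorProduct.map R.toLinearMap LinearMap.id
        ((TensorProduct.assoc k B2 B1 B2).symm (h ⊗ₜ p (g ⊗ₜ a)))))
    (hR2 : ∀ h a b, R (h ⊗ₜ mA (a ⊗ₜ b)) = R (R (h ⊗ₜ a) ⊗ₜ b))
    (hL2 : ∀ h a b, L (h ⊗ₜ mA (a ⊗ₜ b)) =
      mA (TensorProduct.map LinearMap.id L.toLinearMap
        (TensorProduct.assoc k B1 B2 B1 (p (h ⊗ₜ a) ⊗ₜ b))))
    (hL1 : ∀ a, L (eB 1 ⊗ₜ a) = a) (hR1 : ∀ a, R (eB 1 ⊗ₜ a) = counit (R := k) a • eB 1)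
    (hR3 : ∀ h, R (h ⊗ₜ eA 1) = h) (hL3 : ∀ h, L (h ⊗ₜ eA 1) = counit (R := k) h • eA 1) :
    IsBialgebraMaps k (B1 ⊗[k] B2)
      (crossMul mA.toLinearMap mB.toLinearMap p.toLinearMap)
      (crossUnit eA.toLinearMap eB.toLinearMap)
      (crossComul comul comul (TensorProduct.comm k B1 B2).toLinearMap)
      (crossCounit counit counit) := by
  have assocA : ∀ a b c, mA.toLinearMap (mA.toLinearMap (a ⊗ₜ b) ⊗ₜ c) =
      mA.toLinearMap (a ⊗ₜ mA.toLinearMap (b ⊗ₜ c)) := fun a b c =>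
    LinearMap.congr_fun algA.mul_assoc ((a ⊗ₜ b) ⊗ₜ c)
  have assocB : ∀ a b c, mB.toLinearMap (mB.toLinearMap (a ⊗ₜ b) ⊗ₜ c) =
      mB.toLinearMap (a ⊗ₜ mB.toLinearMap (b ⊗ₜ c)) := fun a b c =>
    LinearMap.congr_fun algB.mul_assoc ((a ⊗ₜ b) ⊗ₜ c)
  have oneA : ∀ a, mA.toLinearMap (eA 1 ⊗ₜ a) = a := fun a => LinearMap.congr_fun algA.one_mul a
  have oneB : ∀ a, mB.toLinearMap (eB 1 ⊗ₜ a) = a := fun a => LinearMap.congr_fun algB.one_mul a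
  have Aone : ∀ a, mA.toLinearMap (a ⊗ₜ eA 1) = a := fun a => LinearMap.congr_fun algA.mul_one a
  have Bone : ∀ a, mB.toLinearMap (a ⊗ₜ eB 1) = a := fun a => LinearMap.congr_fun algB.mul_one a
  have hcomul : crossComul comul comul (TensorProduct.comm k B1 B2).toLinearMap =
      comul (R := k) (A := B1 ⊗[k] B2) := crossComul_eq _ _
  have hcounit : crossCounit counit counit = counit (R := k) (A := B1 ⊗[k] B2) := by
    ext a b
    simp [crossCounit, mul_comm]
  have hmul : crossMul mA.toLinearMap mB.toLinearMap p.toLinearMap =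
      (mulHom mA mB p).toLinearMap := by
    ext a h b g
    exact (crossMul_tmul _ _ _ a b h g).trans (mulHom_tmul mA mB p a b h g).symm
  have hunit : crossUnit eA.toLinearMap eB.toLinearMap =
      ((Coalgebra.TensorProduct.map eA eB).comp
        (Coalgebra.TensorProduct.lid k k).symm.toCoalgHom).toLinearMap := rfl
  have hunit1 : crossUnit eA.toLinearMap eB.toLinearMap 1 = eA 1 ⊗ₜ[k] eB 1 := rfl
  refine ⟨⟨?_, ?_, ?_⟩, ?_, ?_, ?_, ?_, ?_⟩
  · apply TensorProduct.ext_threefold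
    intro x y z
    exact assoc_of_distrib mA.toLinearMap mB.toLinearMap assocA assocB p.toLinearMap _
      (fun a h b g => crossMul_tmul _ _ _ a b h g)
      (fun h g c => distrib1 mA mB L R p hp1 hp2 hL hR h g c)
      (fun h b c => distrib2 mA mB L R p hp1 hp2 hR2 hL2 h b c) x y z
  · ext a h
    have e := phi_one_left eB L R p hp1 hp2 hL1 hR1 a
    have e2 : crossMul mA.toLinearMap mB.toLinearMap p.toLinearMap
        ((eA 1 ⊗ₜ[k] eB 1) ⊗ₜ[k] (a ⊗ₜ[k] h)) = a ⊗ₜ h := by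
      rw [crossMul_tmul]
      refine (congrArg (biact mA.toLinearMap mB.toLinearMap (eA 1) h) e).trans ?_
      refine (TensorProduct.map_tmul _ _ _ _).trans ?_
      exact congrArg₂ (fun x y => x ⊗ₜ[k] y) (oneA a) (oneB h)
    exact e2
  · ext a h
    have e := phi_one_right eA L R p hp1 hp2 hR3 hL3 h
    have e2 : crossMul mA.toLinearMap mB.toLinearMap p.toLinearMap
        ((a ⊗ₜ[k] h) ⊗ₜ[k] (eA 1 ⊗ₜ[k] eB 1)) = a ⊗ₜ h := by
      rw [crossMul_tmul]
      refine (congrArg (biact mA.toLinearMap mB.toLinearMap a (eB 1)) e).trans ?_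
      refine (TensorProduct.map_tmul _ _ _ _).trans ?_
      exact congrArg₂ (fun x y => x ⊗ₜ[k] y) (Aone a) (Bone h)
    exact e2
  · rw [hcomul, hcounit]
    exact isCoalgMaps_of (B1 ⊗[k] B2)
  · rw [hcomul, hmul]
    exact (mulHom mA mB p).map_comp_comul.symm
  · rw [hcounit, hmul, (mulHom mA mB p).counit_comp]
    apply TensorProduct.ext'
    intro x y
    simp [mul_comm]
  · rw [hcomul, hunit]
    refine (CoalgHom.map_comp_comul _).symm.trans ?_
    ext
    simp
  · rw [hcounit, hunit, CoalgHom.counit_comp]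
    ext
    simp

end Main

section Build
open CPB
variable {k : Type*} [Field k] {M : Type*} [AddCommGroup M] [Module k M] [Coalgebra k M]

/-- a coalgebra morphism `X ⊗ Y → M` from structure-map identities -/
noncomputable def homOfMaps {X Y : Type*} [AddCommGroup X] [Module k X] [Coalgebra k X]
    [AddCommGroup Y] [Module k Y] [Coalgebra k Y] (f : X ⊗[k] Y →ₗ[k] M)
    (h1 : comul ∘ₗ f = TensorProduct.map f f ∘ₗ
      (TensorProduct.tensorTensorTensorComm k X X Y Y).toLinearMap ∘ₗ
        TensorProduct.map comul comul)
    (h2 : counit ∘ₗ f = LinearMap.mul' k k ∘ₗ TensorProduct.map counit counit) :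
    X ⊗[k] Y →ₗc[k] M where
  toLinearMap := f
  counit_comp := by
    rw [h2]
    ext x y
    simp [mul_comm]
  map_comp_comul := h1.symm

/-- a coalgebra morphism `k → M` from structure-map identities -/
noncomputable def unitOfMaps (f : k →ₗ[k] M)
    (h1 : comul ∘ₗ f = TensorProduct.map f f ∘ₗ (TensorProduct.lid k k).symm.toLinearMap)
    (h2 : counit ∘ₗ f = LinearMap.id) : k →ₗc[k] M where
  toLinearMap := f
  counit_comp := by
    rw [h2]
    ext
    simp
  map_comp_comul := by
    rw [h1]
    ext
    simp

end Build

end DCP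

namespace CPB

variable {k : Type*} [Field k] {B1 B2 : Type*}
  [AddCommGroup B1] [Module k B1] [AddCommGroup B2] [Module k B2]

/-- Corollary 2.17, case `[0,0;1,1]` in the symmetric category of vector spaces:
a matched pair of bialgebras `(B₁, B₂, μ_l, μ_r)` yields the double cross product
bialgebra `B₁ ⋈ B₂` with multiplication
`(m₁ ⊗ m₂) ∘ (id ⊗ (μ_l ⊗ μ_r) ∘ (id ⊗ τ ⊗ id) ∘ (Δ₂ ⊗ Δ₁) ⊗ id)` and the tensor product
comultiplication `(id ⊗ τ ⊗ id) ∘ (Δ₁ ⊗ Δ₂)`. -/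
theorem matchedPair_doubleCrossProduct
    (m1 : (B1 ⊗[k] B1) →ₗ[k] B1) (eta1 : k →ₗ[k] B1)
    (delta1 : B1 →ₗ[k] (B1 ⊗[k] B1)) (eps1 : B1 →ₗ[k] k)
    (m2 : (B2 ⊗[k] B2) →ₗ[k] B2) (eta2 : k →ₗ[k] B2)
    (delta2 : B2 →ₗ[k] (B2 ⊗[k] B2)) (eps2 : B2 →ₗ[k] k)
    (actL : (B2 ⊗[k] B1) →ₗ[k] B1) (actR : (B2 ⊗[k] B1) →ₗ[k] B2)
    (hb1 : IsBialgebraMaps k B1 m1 eta1 delta1 eps1)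
    (hb2 : IsBialgebraMaps k B2 m2 eta2 delta2 eps2)
    -- `μ_l` is a left action and `μ_r` a right action
    (hactL_act : actL ∘ₗ ((merge2 m2) : (B2 ⊗[k] (B2 ⊗[k] B1)) →ₗ[k] (B2 ⊗[k] B1)) =
      actL ∘ₗ ((skp actL) : (B2 ⊗[k] (B2 ⊗[k] B1)) →ₗ[k] (B2 ⊗[k] B1)))
    (hactL_unit : actL ∘ₗ TensorProduct.map eta2 LinearMap.id ∘ₗ
      (TensorProduct.lid k B1).symm.toLinearMap = LinearMap.id)
    (hactR_act : actR ∘ₗ ((skp m1) : (B2 ⊗[k] (B1 ⊗[k] B1)) →ₗ[k] (B2 ⊗[k] B1)) =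
      actR ∘ₗ ((merge2 actR) : (B2 ⊗[k] (B1 ⊗[k] B1)) →ₗ[k] (B2 ⊗[k] B1)))
    (hactR_unit : actR ∘ₗ TensorProduct.map LinearMap.id eta1 ∘ₗ
      (TensorProduct.rid k B2).symm.toLinearMap = LinearMap.id)
    -- `B₁` is a left `B₂`-module coalgebra
    (hmcL : ((delta1 : B1 →ₗ[k] (B1 ⊗[k] B1))
        ∘ₗ (actL : (B2 ⊗[k] B1) →ₗ[k] B1)
      =
      ((skp actL) : (B1 ⊗[k] (B2 ⊗[k] B1)) →ₗ[k] (B1 ⊗[k] B1))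
        ∘ₗ ((merge2 actL) : (B2 ⊗[k] (B1 ⊗[k] (B2 ⊗[k] B1))) →ₗ[k] (B1 ⊗[k] (B2 ⊗[k] B1)))
        ∘ₗ ((skp swap2) : (B2 ⊗[k] (B2 ⊗[k] (B1 ⊗[k] B1))) →ₗ[k] (B2 ⊗[k] (B1 ⊗[k] (B2 ⊗[k] B1))))
        ∘ₗ ((skp (skp delta1)) : (B2 ⊗[k] (B2 ⊗[k] B1)) →ₗ[k] (B2 ⊗[k] (B2 ⊗[k] (B1 ⊗[k] B1))))
        ∘ₗ ((split2 delta2) : (B2 ⊗[k] B1) →ₗ[k] (B2 ⊗[k] (B2 ⊗[k] B1)))))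
    (hepsL : eps1 ∘ₗ actL = LinearMap.mul' k k ∘ₗ TensorProduct.map eps2 eps1)
    -- `B₂` is a right `B₁`-module coalgebra
    (hmcR : ((delta2 : B2 →ₗ[k] (B2 ⊗[k] B2))
        ∘ₗ (actR : (B2 ⊗[k] B1) →ₗ[k] B2)
      =
      ((skp actR) : (B2 ⊗[k] (B2 ⊗[k] B1)) →ₗ[k] (B2 ⊗[k] B2))
        ∘ₗ ((merge2 actR) : (B2 ⊗[k] (B1 ⊗[k] (B2 ⊗[k] B1))) →ₗ[k] (B2 ⊗[k] (B2 ⊗[k] B1)))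
        ∘ₗ ((skp swap2) : (B2 ⊗[k] (B2 ⊗[k] (B1 ⊗[k] B1))) →ₗ[k] (B2 ⊗[k] (B1 ⊗[k] (B2 ⊗[k] B1))))
        ∘ₗ ((skp (skp delta1)) : (B2 ⊗[k] (B2 ⊗[k] B1)) →ₗ[k] (B2 ⊗[k] (B2 ⊗[k] (B1 ⊗[k] B1))))
        ∘ₗ ((split2 delta2) : (B2 ⊗[k] B1) →ₗ[k] (B2 ⊗[k] (B2 ⊗[k] B1)))))
    (hepsR : eps2 ∘ₗ actR = LinearMap.mul' k k ∘ₗ TensorProduct.map eps2 eps1)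
    -- the matched pair identities (2.24)
    (hma1 : ((actR : (B2 ⊗[k] B1) →ₗ[k] B2)
        ∘ₗ ((merge2 m2) : (B2 ⊗[k] (B2 ⊗[k] B1)) →ₗ[k] (B2 ⊗[k] B1))
      =
      (m2 : (B2 ⊗[k] B2) →ₗ[k] B2)
        ∘ₗ ((merge2 actR) : (B2 ⊗[k] (B1 ⊗[k] B2)) →ₗ[k] (B2 ⊗[k] B2))
        ∘ₗ ((skp (skp actR)) : (B2 ⊗[k] (B1 ⊗[k] (B2 ⊗[k] B1))) →ₗ[k] (B2 ⊗[k] (B1 ⊗[k] B2)))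
        ∘ₗ ((skp (merge2 actL)) : (B2 ⊗[k] (B2 ⊗[k] (B1 ⊗[k] (B2 ⊗[k] B1)))) →ₗ[k] (B2 ⊗[k] (B1 ⊗[k] (B2 ⊗[k] B1))))
        ∘ₗ ((skp (skp swap2)) : (B2 ⊗[k] (B2 ⊗[k] (B2 ⊗[k] (B1 ⊗[k] B1)))) →ₗ[k] (B2 ⊗[k] (B2 ⊗[k] (B1 ⊗[k] (B2 ⊗[k] B1)))))
        ∘ₗ ((skp (skp (skp delta1))) : (B2 ⊗[k] (B2 ⊗[k] (B2 ⊗[k] B1))) →ₗ[k] (B2 ⊗[k] (B2 ⊗[k] (B2 ⊗[k] (B1 ⊗[k] B1)))))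
        ∘ₗ ((skp (split2 delta2)) : (B2 ⊗[k] (B2 ⊗[k] B1)) →ₗ[k] (B2 ⊗[k] (B2 ⊗[k] (B2 ⊗[k] B1))))))
    (hma2 : ((actL : (B2 ⊗[k] B1) →ₗ[k] B1)
        ∘ₗ ((skp m1) : (B2 ⊗[k] (B1 ⊗[k] B1)) →ₗ[k] (B2 ⊗[k] B1))
      =
      (m1 : (B1 ⊗[k] B1) →ₗ[k] B1)
        ∘ₗ ((skp actL) : (B1 ⊗[k] (B2 ⊗[k] B1)) →ₗ[k] (B1 ⊗[k] B1))
        ∘ₗ ((skp (merge2 actR)) : (B1 ⊗[k] (B2 ⊗[k] (B1 ⊗[k] B1))) →ₗ[k] (B1 ⊗[k] (B2 ⊗[k] B1)))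
        ∘ₗ ((merge2 actL) : (B2 ⊗[k] (B1 ⊗[k] (B2 ⊗[k] (B1 ⊗[k] B1)))) →ₗ[k] (B1 ⊗[k] (B2 ⊗[k] (B1 ⊗[k] B1))))
        ∘ₗ ((skp swap2) : (B2 ⊗[k] (B2 ⊗[k] (B1 ⊗[k] (B1 ⊗[k] B1)))) →ₗ[k] (B2 ⊗[k] (B1 ⊗[k] (B2 ⊗[k] (B1 ⊗[k] B1)))))
        ∘ₗ ((skp (skp (split2 delta1))) : (B2 ⊗[k] (B2 ⊗[k] (B1 ⊗[k] B1))) →ₗ[k] (B2 ⊗[k] (B2 ⊗[k] (B1 ⊗[k] (B1 ⊗[k] B1)))))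
        ∘ₗ ((split2 delta2) : (B2 ⊗[k] (B1 ⊗[k] B1)) →ₗ[k] (B2 ⊗[k] (B2 ⊗[k] (B1 ⊗[k] B1))))))
    (hunitR : actR ∘ₗ TensorProduct.map eta2 LinearMap.id ∘ₗ
      (TensorProduct.lid k B1).symm.toLinearMap = eta2 ∘ₗ eps1)
    (hunitL : actL ∘ₗ TensorProduct.map LinearMap.id eta1 ∘ₗ
      (TensorProduct.rid k B2).symm.toLinearMap = eta1 ∘ₗ eps2)
    (hcomp : (((skp actL) : (B2 ⊗[k] (B2 ⊗[k] B1)) →ₗ[k] (B2 ⊗[k] B1))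
        ∘ₗ ((merge2 actR) : (B2 ⊗[k] (B1 ⊗[k] (B2 ⊗[k] B1))) →ₗ[k] (B2 ⊗[k] (B2 ⊗[k] B1)))
        ∘ₗ ((skp swap2) : (B2 ⊗[k] (B2 ⊗[k] (B1 ⊗[k] B1))) →ₗ[k] (B2 ⊗[k] (B1 ⊗[k] (B2 ⊗[k] B1))))
        ∘ₗ ((skp (skp delta1)) : (B2 ⊗[k] (B2 ⊗[k] B1)) →ₗ[k] (B2 ⊗[k] (B2 ⊗[k] (B1 ⊗[k] B1))))
        ∘ₗ ((split2 delta2) : (B2 ⊗[k] B1) →ₗ[k] (B2 ⊗[k] (B2 ⊗[k] B1)))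
      =
      ((TensorProduct.comm k B1 B2).toLinearMap : (B1 ⊗[k] B2) →ₗ[k] (B2 ⊗[k] B1))
        ∘ₗ ((skp actR) : (B1 ⊗[k] (B2 ⊗[k] B1)) →ₗ[k] (B1 ⊗[k] B2))
        ∘ₗ ((merge2 actL) : (B2 ⊗[k] (B1 ⊗[k] (B2 ⊗[k] B1))) →ₗ[k] (B1 ⊗[k] (B2 ⊗[k] B1)))
        ∘ₗ ((skp swap2) : (B2 ⊗[k] (B2 ⊗[k] (B1 ⊗[k] B1))) →ₗ[k] (B2 ⊗[k] (B1 ⊗[k] (B2 ⊗[k] B1))))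
        ∘ₗ ((skp (skp delta1)) : (B2 ⊗[k] (B2 ⊗[k] B1)) →ₗ[k] (B2 ⊗[k] (B2 ⊗[k] (B1 ⊗[k] B1))))
        ∘ₗ ((split2 delta2) : (B2 ⊗[k] B1) →ₗ[k] (B2 ⊗[k] (B2 ⊗[k] B1))))) :
    IsBialgebraMaps k (B1 ⊗[k] B2)
      (crossMul m1 m2 (mpPhi21 delta1 delta2 actL actR)) (crossUnit eta1 eta2)
      (crossComul delta1 delta2 (TensorProduct.comm k B1 B2).toLinearMap)
      (crossCounit eps1 eps2) := by
  let c1 : Coalgebra k B1 := DCP.toCoalgebra hb1.coalg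
  let c2 : Coalgebra k B2 := DCP.toCoalgebra hb2.coalg
  rw [DCP.strand_eq] at hmcL hmcR
  rw [DCP.strand_eq, DCP.strand_eq] at hcomp
  have hphi : mpPhi21 delta1 delta2 actL actR = TensorProduct.map actL actR ∘ₗ
      (TensorProduct.tensorTensorTensorComm k B2 B2 B1 B1).toLinearMap ∘ₗ
      TensorProduct.map delta2 delta1 := DCP.strand_eq _ _ _ _
  let mA : B1 ⊗[k] B1 →ₗc[k] B1 := DCP.homOfMaps m1 hb1.comul_mul hb1.counit_mul
  let mB : B2 ⊗[k] B2 →ₗc[k] B2 := DCP.homOfMaps m2 hb2.comul_mul hb2.counit_mul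
  let eA : k →ₗc[k] B1 := DCP.unitOfMaps eta1 hb1.comul_unit hb1.counit_unit
  let eB : k →ₗc[k] B2 := DCP.unitOfMaps eta2 hb2.comul_unit hb2.counit_unit
  let L : B2 ⊗[k] B1 →ₗc[k] B1 := DCP.homOfMaps actL hmcL hepsL
  let R : B2 ⊗[k] B1 →ₗc[k] B2 := DCP.homOfMaps actR hmcR hepsR
  let p : B2 ⊗[k] B1 →ₗc[k] B1 ⊗[k] B2 := DCP.convHom L R hcomp
  have hp : ∀ x, mpPhi21 delta1 delta2 actL actR x = p x := fun x =>
    LinearMap.congr_fun hphi x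
  have hp' : mpPhi21 delta1 delta2 actL actR = p.toLinearMap := LinearMap.ext hp
  rw [hp']
  refine DCP.assemble mA mB eA eB hb1.alg hb2.alg L R p (DCP.pr1_conv L R hcomp)
    (DCP.pr2_conv L R hcomp) ?_ ?_ ?_ ?_ ?_ ?_ ?_ ?_
  · intro h g a
    exact LinearMap.congr_fun hactL_act (h ⊗ₜ (g ⊗ₜ a))
  · intro h g a
    simp only [DCP.skp_comp] at hma1
    have e := LinearMap.congr_fun hma1 (h ⊗ₜ (g ⊗ₜ a))
    refine e.trans ?_
    have e3 := hp (g ⊗ₜ a)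
    rw [← e3]
    rfl
  · intro h a b
    exact LinearMap.congr_fun hactR_act (h ⊗ₜ (a ⊗ₜ b))
  · intro h a b
    have e := LinearMap.congr_fun hma2 (h ⊗ₜ (a ⊗ₜ b))
    refine e.trans ?_
    exact congrArg m1 (DCP.strand3_eq actL actR delta1 delta2 h a b)
  · intro a
    exact LinearMap.congr_fun hactL_unit a
  · intro a
    have e := LinearMap.congr_fun hunitR a
    refine e.trans ?_
    change eta2 (eps1 a) = eps1 a • eta2 1
    rw [← map_smul, smul_eq_mul, mul_one]
  · intro h
    exact LinearMap.congr_fun hactR_unit h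
  · intro h
    have e := LinearMap.congr_fun hunitL h
    refine e.trans ?_
    change eta1 (eps2 h) = eps2 h • eta1 1
    rw [← map_smul, smul_eq_mul, mul_one]

end CPB
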